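/- arXiv:2310.05326 — 7 statements merged into one kernel-verified Lean document; each statement's English description precedes it below -/
import Mathlib

section
/- Let n ≥ 2, N ≥ n+1, let β₁, …, β_N ∈ (0,∞), and let v₁, …, v_N ∈ S^{n−1} be unit vectors not contained in any closed hemisphere. Let P ∈ P(v₁, …, v_N). Then there exists a unique point γ(P) in the interior of P at which Φ_P attains its maximum over P; moreover Φ_P(γ) < Φ_P(γ(P)) for every γ ∈ P with γ ≠ γ(P). -/
open scoped RealInnerProductSpace

/-- The support function of a set `K ⊆ ℝⁿ`. -/
noncomputable def supportFn {n : ℕ} (K : Set (EuclideanSpace ℝ (Fin n)))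
    (x : EuclideanSpace ℝ (Fin n)) : ℝ :=
  sSup ((fun y => ⟪x, y⟫) '' K)

/-- Extended-real logarithm with the convention `log x = -∞` for `x ≤ 0`. -/
noncomputable def elog (x : ℝ) : EReal :=
  if x ≤ 0 then ⊥ else ((Real.log x : ℝ) : EReal)

/-- The functional `Φ_P(γ) = Σ β_k log(h(P, v_k) − γ·v_k)`, valued in the extended reals. -/
noncomputable def Phi {n N : ℕ} (β : Fin N → ℝ) (v : Fin N → EuclideanSpace ℝ (Fin n))
    (P : Set (EuclideanSpace ℝ (Fin n))) (γ : EuclideanSpace ℝ (Fin n)) : EReal :=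
  ∑ k, (β k : EReal) * elog (supportFn P (v k) - ⟪γ, v k⟫)

/-- If all arguments of the logarithms are positive, `Phi` is a real number. -/
theorem Phi_eq_coe {n N : ℕ} (β : Fin N → ℝ) (v : Fin N → EuclideanSpace ℝ (Fin n))
    (P : Set (EuclideanSpace ℝ (Fin n))) (γ : EuclideanSpace ℝ (Fin n))
    (h : ∀ k, 0 < supportFn P (v k) - ⟪γ, v k⟫) :
    Phi β v P γ = ((∑ k, β k * Real.log (supportFn P (v k) - ⟪γ, v k⟫) : ℝ) : EReal) := by
  have coe_sum (s : Finset (Fin N)) (f : Fin N → ℝ) :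
      ((∑ k ∈ s, f k : ℝ) : EReal) = ∑ k ∈ s, (f k : EReal) :=
    map_sum (⟨⟨Real.toEReal, EReal.coe_zero⟩, EReal.coe_add⟩ : ℝ →+ EReal) f s
  rw [Phi, coe_sum]
  refine Finset.sum_congr rfl fun k _ => ?_
  rw [elog, if_neg (h k).not_ge, EReal.coe_mul]

/-- If some argument of the logarithms is nonpositive, `Phi` is `-∞`. -/
theorem Phi_eq_bot {n N : ℕ} (β : Fin N → ℝ) (hβ : ∀ k, 0 < β k)
    (v : Fin N → EuclideanSpace ℝ (Fin n))
    (P : Set (EuclideanSpace ℝ (Fin n))) (γ : EuclideanSpace ℝ (Fin n)) (k : Fin N)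
    (h : supportFn P (v k) - ⟪γ, v k⟫ ≤ 0) : Phi β v P γ = ⊥ := by
  rw [Phi, ← Finset.add_sum_erase _ _ (Finset.mem_univ k), elog, if_pos h,
    EReal.coe_mul_bot_of_pos (hβ k), EReal.bot_add]

/-- Vectors not contained in a closed hemisphere separate points. -/
theorem exists_inner_ne_of_ne {n N : ℕ} (v : Fin N → EuclideanSpace ℝ (Fin n))
    (hhemi : ∀ u : EuclideanSpace ℝ (Fin n), ‖u‖ = 1 → ∃ k, 0 < ⟪v k, u⟫)
    {x y : EuclideanSpace ℝ (Fin n)} (hxy : x ≠ y) : ∃ k, ⟪x, v k⟫ ≠ ⟪y, v k⟫ := by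
  obtain ⟨k, hk⟩ := hhemi (‖x - y‖⁻¹ • (x - y))
    (norm_smul_inv_norm (𝕜 := ℝ) (sub_ne_zero.2 hxy))
  refine ⟨k, fun h => ?_⟩
  rw [inner_smul_right, real_inner_comm, inner_sub_left, h, sub_self, mul_zero] at hk
  exact hk.false

/-- Strict midpoint concavity of a weighted sum of logarithms. -/
theorem sum_mul_log_midpoint_lt {ι : Type*} [Fintype ι] (β a b : ι → ℝ) (hβ : ∀ k, 0 < β k)
    (ha : ∀ k, 0 < a k) (hb : ∀ k, 0 < b k) (hab : ∃ k, a k ≠ b k) :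
    (1 / 2 : ℝ) * ∑ k, β k * Real.log (a k) + (1 / 2) * ∑ k, β k * Real.log (b k) <
      ∑ k, β k * Real.log ((1 / 2) * a k + (1 / 2) * b k) := by
  have strict (k : ι) (h : a k ≠ b k) : (1 / 2 : ℝ) * Real.log (a k) + (1 / 2) * Real.log (b k) <
      Real.log ((1 / 2) * a k + (1 / 2) * b k) :=
    strictConcaveOn_log_Ioi.2 (ha k) (hb k) h (by norm_num) (by norm_num) (by norm_num)
  rw [Finset.mul_sum, Finset.mul_sum, ← Finset.sum_add_distrib]
  obtain ⟨j, hj⟩ := hab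
  refine Finset.sum_lt_sum (fun k _ => ?_) ⟨j, Finset.mem_univ j, ?_⟩
  · by_cases h : a k = b k
    · rw [h, ← add_mul, ← add_mul]
      norm_num
    · nlinarith [mul_lt_mul_of_pos_left (strict k h) (hβ k)]
  · nlinarith [mul_lt_mul_of_pos_left (strict j hj) (hβ j)]

/-- An interior point of a subset of a half-space satisfies the defining inequality strictly. -/
theorem inner_lt_of_mem_interior {E : Type*} [NormedAddCommGroup E] [InnerProductSpace ℝ E]
    {s : Set E} {w x : E} {c : ℝ} (hw : ‖w‖ = 1) (hs : ∀ y ∈ s, ⟪y, w⟫ ≤ c)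
    (hx : x ∈ interior s) : ⟪x, w⟫ < c := by
  obtain ⟨ε, hε, hball⟩ := Metric.mem_nhds_iff.1 (mem_interior_iff_mem_nhds.1 hx)
  have hmem : x + (ε / 2) • w ∈ s := hball (by
    rw [mem_ball_iff_norm, add_sub_cancel_left, norm_smul, hw, Real.norm_of_nonneg (by positivity)]
    linarith)
  have h := hs _ hmem
  rw [inner_add_left, real_inner_smul_left, real_inner_self_eq_norm_sq, hw] at h
  linarith

theorem existence_uniqueness_interior_maximizer
    {n N : ℕ} (hn : 2 ≤ n) (hN : n + 1 ≤ N)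
    (β : Fin N → ℝ) (hβ : ∀ k, 0 < β k)
    (v : Fin N → EuclideanSpace ℝ (Fin n)) (hv : ∀ k, ‖v k‖ = 1)
    (hhemi : ∀ u : EuclideanSpace ℝ (Fin n), ‖u‖ = 1 → ∃ k, 0 < ⟪v k, u⟫)
    (P : Set (EuclideanSpace ℝ (Fin n)))
    (hPcpt : IsCompact P) (hPconv : Convex ℝ P) (hPint : (interior P).Nonempty)
    (hPfacets : P = ⋂ k, {x | ⟪x, v k⟫ ≤ supportFn P (v k)}) :
    ∃! γ₀ : EuclideanSpace ℝ (Fin n), γ₀ ∈ interior P ∧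
      (∀ γ ∈ P, Phi β v P γ ≤ Phi β v P γ₀) ∧
      (∀ γ ∈ P, γ ≠ γ₀ → Phi β v P γ < Phi β v P γ₀) := by
  set f : Fin N → EuclideanSpace ℝ (Fin n) → ℝ :=
    fun k γ => supportFn P (v k) - ⟪γ, v k⟫ with hf
  have mem_iff (γ) : γ ∈ P ↔ ∀ k, 0 ≤ f k γ := by
    conv_lhs => rw [hPfacets]
    simp [hf]
  have fcont (k) : Continuous (f k) := by fun_prop
  have interior_of_pos (γ) (h : ∀ k, 0 < f k γ) : γ ∈ interior P := by
    have hopen : IsOpen {x | ∀ k, 0 < f k x} := by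
      simp only [Set.ofPred_forall]
      exact isOpen_iInter_of_finite fun k => isOpen_lt continuous_const (fcont k)
    exact interior_maximal (fun x hx => (mem_iff x).2 fun k => (hx k).le) hopen h
  obtain ⟨p, hp⟩ := hPint
  have hp_pos (k) : 0 < f k p :=
    sub_pos.2 (inner_lt_of_mem_interior (hv k) (fun y hy => sub_nonneg.1 ((mem_iff y).1 hy k)) hp)
  have Fcont : Continuous fun γ => ∏ k, f k γ ^ β k :=
    continuous_finsetProd _ fun k _ => (fcont k).rpow_const fun _ => Or.inr (hβ k).le
  obtain ⟨γ₀, hγ₀, hmax⟩ := hPcpt.exists_isMaxOn ⟨p, interior_subset hp⟩ Fcont.continuousOn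
  have hF₀ : 0 < ∏ k, f k γ₀ ^ β k :=
    (Finset.prod_pos fun k _ => Real.rpow_pos_of_pos (hp_pos k) _).trans_le
      (hmax (interior_subset hp))
  have hpos₀ (k) : 0 < f k γ₀ := by
    refine ((mem_iff γ₀).1 hγ₀ k).lt_of_ne' fun h => hF₀.ne' ?_
    exact Finset.prod_eq_zero (Finset.mem_univ k) (by rw [h, Real.zero_rpow (hβ k).ne'])
  have log_prod (γ) (h : ∀ k, 0 < f k γ) :
      Real.log (∏ k, f k γ ^ β k) = ∑ k, β k * Real.log (f k γ) := by
    rw [Real.log_prod fun k _ => (Real.rpow_pos_of_pos (h k) _).ne']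
    exact Finset.sum_congr rfl fun k _ => Real.log_rpow (h k) _
  have sum_le (γ) (h : ∀ k, 0 < f k γ) :
      ∑ k, β k * Real.log (f k γ) ≤ ∑ k, β k * Real.log (f k γ₀) := by
    rw [← log_prod γ h, ← log_prod γ₀ hpos₀]
    exact Real.log_le_log (Finset.prod_pos fun k _ => Real.rpow_pos_of_pos (h k) _)
      (hmax ((mem_iff γ).2 fun k => (h k).le))
  have strict (γ) (hne : γ ≠ γ₀) : Phi β v P γ < Phi β v P γ₀ := by
    rw [Phi_eq_coe β v P γ₀ hpos₀]
    by_cases h : ∀ k, 0 < f k γ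
    · rw [Phi_eq_coe β v P γ h, EReal.coe_lt_coe_iff]
      obtain ⟨j, hj⟩ := exists_inner_ne_of_ne v hhemi hne
      have hmid (k) : f k ((1 / 2 : ℝ) • γ + (1 / 2 : ℝ) • γ₀) =
          1 / 2 * f k γ + 1 / 2 * f k γ₀ := by
        simp only [hf, inner_add_left, real_inner_smul_left]
        ring
      have hlt := sum_mul_log_midpoint_lt β (f · γ) (f · γ₀) hβ h hpos₀
        ⟨j, fun e => hj (sub_right_injective e)⟩
      have hle := sum_le ((1 / 2 : ℝ) • γ + (1 / 2 : ℝ) • γ₀) fun k => by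
        rw [hmid]
        linarith [h k, hpos₀ k]
      simp only [hmid] at hle
      change ∑ k, β k * Real.log (f k γ) < ∑ k, β k * Real.log (f k γ₀)
      linarith
    · push Not at h
      obtain ⟨k, hk⟩ := h
      rw [Phi_eq_bot β hβ v P γ k hk]
      exact EReal.bot_lt_coe _
  refine ⟨γ₀, ⟨interior_of_pos γ₀ hpos₀, fun γ _ => ?_, fun γ _ => strict γ⟩, ?_⟩
  · obtain rfl | hne := eq_or_ne γ γ₀
    · exact le_rfl
    · exact (strict γ hne).le
  · rintro γ ⟨-, hγ, -⟩
    by_contra hne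
    exact (hγ γ₀ hγ₀).not_gt (strict γ hne)
end

section
/- Let v₁, …, v_N ∈ S^{n−1} (N ≥ n+1, n ≥ 2) be unit vectors not contained in any closed hemisphere that are in general position in dimension n, and let (P_i) be a sequence of polytopes in P(v₁, …, v_N). If the outer radii of the P_i are not uniformly bounded in i, then the inner radii of the P_i are not uniformly bounded in i either. -/
open scoped RealInnerProductSpace

/-- The outer radius of a convex body: the infimum of all `R > 0` such that the body is
contained in some closed ball of radius `R`. -/
noncomputable def outerRadius {n : ℕ} (K : Set (EuclideanSpace ℝ (Fin n))) : ℝ :=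
  sInf {R : ℝ | 0 < R ∧ ∃ c, K ⊆ Metric.closedBall c R}

/-- The inner radius of a convex body: the supremum of all `r > 0` such that some closed
ball of radius `r` is contained in the body. -/
noncomputable def innerRadius {n : ℕ} (K : Set (EuclideanSpace ℝ (Fin n))) : ℝ :=
  sSup {r : ℝ | 0 < r ∧ ∃ c, Metric.closedBall c r ⊆ K}

/-- If no direction has negative inner product with every point of a finite set, then the origin
is a convex combination of its points. -/
theorem exists_convex_weights_of_forall_exists_inner_nonneg {ι E : Type*}
    [NormedAddCommGroup E] [InnerProductSpace ℝ E] [CompleteSpace E]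
    (v : ι → E) (I : Finset ι) (h : ¬ ∃ u, ∀ k ∈ I, ⟪v k, u⟫ < 0) :
    ∃ w : ι → ℝ, (∀ k ∈ I, 0 ≤ w k) ∧ ∑ k ∈ I, w k = 1 ∧ ∑ k ∈ I, w k • v k = 0 := by
  classical
  let L : (I → ℝ) →ₗ[ℝ] E := ∑ k : I, (LinearMap.proj k).smulRight (v k)
  have hL : ∀ w, L w = ∑ k : I, w k • v k := fun w => by simp [L]
  have hmem : (0 : E) ∈ L '' stdSimplex ℝ I := by
    by_contra h0
    have hcl : IsClosed (L '' stdSimplex ℝ I) :=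
      ((isCompact_stdSimplex ℝ I).image L.continuous_of_finiteDimensional).isClosed
    obtain ⟨f, a, hfa, ha⟩ := geometric_hahn_banach_closed_point
      ((convex_stdSimplex ℝ I).linear_image L) hcl h0
    refine h ⟨(InnerProductSpace.toDual ℝ E).symm f, fun k hk => ?_⟩
    have h1 := hfa _ ⟨_, single_mem_stdSimplex ℝ (⟨k, hk⟩ : I), rfl⟩
    have h2 : L (Pi.single ⟨k, hk⟩ 1) = v k := by
      rw [hL, Finset.sum_eq_single ⟨k, hk⟩] <;> simp +contextual
    rw [real_inner_comm, InnerProductSpace.toDual_symm_apply]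
    rw [map_zero] at ha
    rw [h2] at h1
    linarith
  obtain ⟨w, ⟨hw0, hw1⟩, hw⟩ := hmem
  rw [hL] at hw
  refine ⟨fun k => if hk : k ∈ I then w ⟨k, hk⟩ else 0, fun k hk => ?_, ?_, ?_⟩
  · simpa [hk] using hw0 ⟨k, hk⟩
  · rw [← hw1, ← Finset.sum_coe_sort I]
    simp
  · rw [← hw, ← Finset.sum_coe_sort I]
    simp

/-- A linearly dependent subfamily of vectors in general position separates points. -/
theorem eq_zero_of_inner_eq_zero_of_general_position {n N : ℕ} (hN : n ≤ N)
    (v : Fin N → EuclideanSpace ℝ (Fin n))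
    (hgen : ∀ s : Finset (Fin N), s.card = n → LinearIndependent ℝ (fun i : s => v i))
    (J : Finset (Fin N)) (hJ : ¬ LinearIndependent ℝ (fun i : J => v i))
    (y : EuclideanSpace ℝ (Fin n)) (hy : ∀ k ∈ J, ⟪v k, y⟫ = 0) : y = 0 := by
  have hcard : n ≤ J.card := by
    by_contra! hlt
    obtain ⟨s, hJs, hs⟩ := Finset.exists_superset_card_eq hlt.le (by simpa using hN)
    exact hJ ((hgen s hs).comp (fun i : J => (⟨i, hJs i.2⟩ : s))
      fun a b hab => Subtype.ext (congrArg (fun x : s => (x : Fin N)) hab))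
  obtain ⟨s, hsJ, hs⟩ := Finset.exists_subset_card_eq hcard
  have hspan := (hgen s hs).span_eq_top_of_card_eq_finrank' (by simp [hs])
  have hle : Submodule.span ℝ (Set.range fun i : s => v i) ≤ (ℝ ∙ y)ᗮ := by
    rw [Submodule.span_le]
    rintro _ ⟨i, rfl⟩
    rw [SetLike.mem_coe, Submodule.mem_orthogonal_singleton_iff_inner_left]
    exact hy i (hsJ i.2)
  have hyy : y ∈ (ℝ ∙ y)ᗮ := hle (hspan ▸ Submodule.mem_top)
  exact inner_self_eq_zero.1 (Submodule.mem_orthogonal_singleton_iff_inner_left.1 hyy)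

/-- Among vectors in general position, a subfamily which lies in no open half-space through the
origin cuts out bounded polyhedra. -/
theorem exists_norm_le_of_general_position {n N : ℕ} (hN : n ≤ N)
    (v : Fin N → EuclideanSpace ℝ (Fin n))
    (hgen : ∀ s : Finset (Fin N), s.card = n → LinearIndependent ℝ (fun i : s => v i))
    (I : Finset (Fin N)) (hI : ¬ ∃ u, ∀ k ∈ I, ⟪v k, u⟫ < 0) :
    ∃ C : ℝ, ∀ (r : ℝ) (y : EuclideanSpace ℝ (Fin n)), 0 ≤ r →
      (∀ k ∈ I, ⟪v k, y⟫ ≤ r) → ‖y‖ ≤ C * r := by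
  classical
  obtain ⟨w, hw0, hw1, hwv⟩ := exists_convex_weights_of_forall_exists_inner_nonneg v I hI
  let J := I.filter fun k => w k ≠ 0
  have hJpos : ∀ k ∈ J, 0 < w k := fun k hk =>
    (hw0 k (Finset.mem_filter.1 hk).1).lt_of_ne' (Finset.mem_filter.1 hk).2
  have hJdep : ¬ LinearIndependent ℝ (fun i : J => v i) := by
    intro hli
    have hsum : ∑ k ∈ J, w k • v k = 0 := by
      rw [← hwv]
      exact Finset.sum_filter_of_ne fun k _ hk hk0 => hk (by rw [hk0, zero_smul])
    have hz := Fintype.linearIndependent_iff.1 hli (fun i => w i)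
      (by rw [← hsum, ← Finset.sum_coe_sort J fun k => w k • v k])
    have hI0 : ∑ k ∈ I, w k = 0 := Finset.sum_eq_zero fun k hk => by
      by_contra hk0
      exact hk0 (hz ⟨k, Finset.mem_filter.2 ⟨hk, hk0⟩⟩)
    linarith
  let L : EuclideanSpace ℝ (Fin n) →ₗ[ℝ] (J → ℝ) := LinearMap.pi fun k => innerₗ _ (v k)
  have hker : LinearMap.ker L = ⊥ := by
    rw [LinearMap.ker_eq_bot']
    intro y hy
    exact eq_zero_of_inner_eq_zero_of_general_position hN v hgen J hJdep y
      fun k hk => congrFun hy ⟨k, hk⟩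
  obtain ⟨K, -, hK⟩ := L.exists_antilipschitzWith hker
  obtain ⟨A, hA⟩ := Finite.exists_le fun k : J => (w k)⁻¹
  refine ⟨K * max A 1, fun r y hr hy => ?_⟩
  have hnorm : ‖y‖ ≤ K * ‖L y‖ := by simpa using hK.le_mul_dist y 0
  have hLy : ‖L y‖ ≤ max A 1 * r := by
    refine (pi_norm_le_iff_of_nonneg (by positivity)).2 fun k => ?_
    have hkI := (Finset.mem_filter.1 k.2).1
    have hk := hJpos k k.2
    change |⟪v k, y⟫| ≤ _
    have hzero : ∑ j ∈ I, w j * ⟪v j, y⟫ = 0 := by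
      simpa [sum_inner, real_inner_smul_left] using congrArg (fun x => ⟪x, y⟫) hwv
    have hslack : w k * (r - ⟪v k, y⟫) ≤ ∑ j ∈ I, w j * (r - ⟪v j, y⟫) :=
      Finset.single_le_sum (f := fun j => w j * (r - ⟪v j, y⟫))
        (fun j hj => mul_nonneg (hw0 j hj) (sub_nonneg.2 (hy j hj))) hkI
    have htotal : ∑ j ∈ I, w j * (r - ⟪v j, y⟫) = r := by
      simp_rw [mul_sub]
      rw [Finset.sum_sub_distrib, hzero, ← Finset.sum_mul, hw1, one_mul, sub_zero]
    have hle : r - ⟪v k, y⟫ ≤ (w k)⁻¹ * r := by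
      rw [inv_mul_eq_div, le_div_iff₀' hk]
      linarith
    have hinv : (w k)⁻¹ * r ≤ max A 1 * r :=
      mul_le_mul_of_nonneg_right ((hA k).trans (le_max_left _ _)) hr
    have hone : r ≤ max A 1 * r := le_mul_of_one_le_left hr (le_max_right _ _)
    exact abs_le.2 ⟨by linarith, (hy k hkI).trans hone⟩
  calc ‖y‖ ≤ K * ‖L y‖ := hnorm
    _ ≤ K * (max A 1 * r) := by gcongr
    _ = K * max A 1 * r := (mul_assoc _ _ _).symm

/-- A compact polyhedron has a largest inscribed ball, and the normals of the facets touching it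
lie in no open half-space through the origin. -/
theorem exists_inscribed_ball_of_isCompact_polyhedron {ι E : Type*} [Fintype ι] [Nonempty ι]
    [NormedAddCommGroup E] [InnerProductSpace ℝ E] {v : ι → E} (hv : ∀ k, ‖v k‖ = 1)
    {h : ι → ℝ} {K : Set E} (hK : IsCompact K) (hne : K.Nonempty)
    (hKv : K = ⋂ k, {x | ⟪x, v k⟫ ≤ h k}) :
    ∃ (c : E) (r : ℝ) (I : Finset ι), 0 ≤ r ∧ Metric.closedBall c r ⊆ K ∧
      (¬ ∃ u, ∀ k ∈ I, ⟪v k, u⟫ < 0) ∧ ∀ k ∈ I, ∀ x ∈ K, ⟪v k, x - c⟫ ≤ r := by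
  classical
  have hmem : ∀ x, x ∈ K ↔ ∀ k, 0 ≤ h k - ⟪v k, x⟫ := fun x => by
    rw [hKv]
    simp [real_inner_comm]
  let f : E → ℝ := fun x => Finset.univ.inf' Finset.univ_nonempty fun k => h k - ⟪v k, x⟫
  have hle : ∀ x k, f x ≤ h k - ⟪v k, x⟫ := fun x k => Finset.inf'_le _ (Finset.mem_univ k)
  have hfc : Continuous f :=
    Continuous.finset_inf'_apply _ fun k _ => by fun_prop
  obtain ⟨c, hcK, hc⟩ := hK.exists_isMaxOn hne hfc.continuousOn
  have hc0 : 0 ≤ f c := (Finset.le_inf'_iff _ _).2 fun k _ => (hmem c).1 hcK k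
  refine ⟨c, f c, Finset.univ.filter fun k => h k - ⟪v k, c⟫ = f c, hc0, ?_, ?_, ?_⟩
  · intro x hx
    refine (hmem x).2 fun k => ?_
    have h1 : ⟪v k, x - c⟫ ≤ f c := by
      refine (real_inner_le_norm _ _).trans ?_
      rw [hv, one_mul]
      exact mem_closedBall_iff_norm.1 hx
    rw [inner_sub_right] at h1
    linarith [hle c k]
  · rintro ⟨u, hu⟩
    have hev : ∀ᶠ t : ℝ in nhdsWithin 0 (Set.Ioi 0), ∀ k, f c < h k - ⟪v k, c + t • u⟫ := by
      refine Filter.eventually_all.2 fun k => ?_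
      by_cases hk : h k - ⟪v k, c⟫ = f c
      · filter_upwards [self_mem_nhdsWithin] with t ht
        have := mul_neg_of_pos_of_neg ht (hu k (by simpa using hk))
        rw [inner_add_right, real_inner_smul_right]
        linarith
      · have hcont : Continuous fun t : ℝ => h k - ⟪v k, c + t • u⟫ := by fun_prop
        refine nhdsWithin_le_nhds (hcont.continuousAt.eventually_const_lt ?_)
        simpa using (hle c k).lt_of_ne' hk
    obtain ⟨t, ht⟩ := hev.exists
    have htK : c + t • u ∈ K := (hmem _).2 fun k => hc0.trans (ht k).le
    have hlt : f c < f (c + t • u) := (Finset.lt_inf'_iff _).2 fun k _ => ht k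
    exact hlt.not_ge (hc htK)
  · intro k hk x hx
    rw [inner_sub_right, ← (Finset.mem_filter.1 hk).2]
    linarith [(hmem x).1 hx k]

theorem le_innerRadius {n : ℕ} (hn : 0 < n) {K : Set (EuclideanSpace ℝ (Fin n))}
    (hK : Bornology.IsBounded K) {c : EuclideanSpace ℝ (Fin n)} {r : ℝ} (hr : 0 < r)
    (hball : Metric.closedBall c r ⊆ K) : r ≤ innerRadius K := by
  refine le_csSup ⟨Metric.diam K, ?_⟩ ⟨hr, c, hball⟩
  rintro s ⟨hs, d, hd⟩
  let e : EuclideanSpace ℝ (Fin n) := EuclideanSpace.single ⟨0, hn⟩ s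
  have he : dist (d + e) d = s := by simp [e, abs_of_pos hs]
  rw [← he]
  exact Metric.dist_le_diam_of_mem hK (hd (Metric.mem_closedBall.2 he.le))
    (hd (Metric.mem_closedBall_self hs.le))

theorem outerRadius_le {n : ℕ} {K : Set (EuclideanSpace ℝ (Fin n))}
    {c : EuclideanSpace ℝ (Fin n)} {R : ℝ} (hR : 0 < R) (hball : K ⊆ Metric.closedBall c R) :
    outerRadius K ≤ R :=
  csInf_le ⟨0, fun _ h => h.1.le⟩ ⟨hR, c, hball⟩

theorem general_position_unbounded_outer_radius_implies_unbounded_inner_radius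
    {n N : ℕ} (hn : 2 ≤ n) (hN : n + 1 ≤ N)
    (v : Fin N → EuclideanSpace ℝ (Fin n)) (hv : ∀ k, ‖v k‖ = 1)
    (hhemi : ∀ u : EuclideanSpace ℝ (Fin n), ‖u‖ = 1 → ∃ k, 0 < ⟪v k, u⟫)
    (hgen : ∀ s : Finset (Fin N), s.card = n →
      LinearIndependent ℝ (fun i : s => v i))
    (P : ℕ → Set (EuclideanSpace ℝ (Fin n)))
    (hPcpt : ∀ i, IsCompact (P i)) (hPconv : ∀ i, Convex ℝ (P i))
    (hPint : ∀ i, (interior (P i)).Nonempty)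
    (hPfacets : ∀ i, P i = ⋂ k, {x | ⟪x, v k⟫ ≤ supportFn (P i) (v k)})
    (hout : ¬ ∃ M : ℝ, ∀ i, outerRadius (P i) ≤ M) :
    ¬ ∃ M : ℝ, ∀ i, innerRadius (P i) ≤ M := by
  classical
  rintro ⟨M, hM⟩
  have : Nonempty (Fin N) := ⟨⟨0, by omega⟩⟩
  have hbound : ∀ I : Finset (Fin N), ∃ C : ℝ, (¬ ∃ u, ∀ k ∈ I, ⟪v k, u⟫ < 0) →
      ∀ (r : ℝ) (y : EuclideanSpace ℝ (Fin n)), 0 ≤ r →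
        (∀ k ∈ I, ⟪v k, y⟫ ≤ r) → ‖y‖ ≤ C * r := fun I => by
    by_cases hI : ∃ u, ∀ k ∈ I, ⟪v k, u⟫ < 0
    · exact ⟨0, fun h => absurd hI h⟩
    · exact (exists_norm_le_of_general_position (by omega) v hgen I hI).imp fun C hC _ => hC
  choose C hC using hbound
  obtain ⟨B, hB⟩ := Finite.exists_le C
  refine hout ⟨max B 0 * max M 0 + 1, fun i => ?_⟩
  obtain ⟨c, r, I, hr, hball, hI, hx⟩ := exists_inscribed_ball_of_isCompact_polyhedron hv
    (hPcpt i) ((hPint i).mono interior_subset) (hPfacets i)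
  have hrM : r ≤ max M 0 := by
    rcases hr.eq_or_lt with rfl | hr0
    · exact le_max_right _ _
    · exact ((le_innerRadius (by omega) (hPcpt i).isBounded hr0 hball).trans (hM i)).trans
        (le_max_left _ _)
  refine outerRadius_le (c := c) (by positivity) fun x hxP => ?_
  rw [mem_closedBall_iff_norm]
  calc ‖x - c‖ ≤ C I * r := hC I hI r _ hr fun k hk => hx k hk x hxP
    _ ≤ max B 0 * max M 0 := by
      gcongr
      exact (hB I).trans (le_max_left _ _)
    _ ≤ max B 0 * max M 0 + 1 := by linarith
end

section
/- Let v₁, …, v_N ∈ S^{n−1} (N ≥ n+1, n ≥ 2) be unit vectors not contained in any closed hemisphere that are in general position in dimension n, and let (P_i) be a sequence of polytopes in P(v₁, …, v_N). If the outer radii of the P_i are not uniformly bounded in i, then the torsional rigidities T(P_i) are not uniformly bounded in i. -/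
open scoped RealInnerProductSpace
open MeasureTheory

/-- The torsional rigidity of `Ω ⊆ ℝⁿ`:
`T(Ω) = sup { (∫ |u|)² / ∫ |∇u|² : u` smooth, compactly supported in the interior of `Ω`,
with `∫ |∇u|² > 0 }`. -/
noncomputable def torsion {n : ℕ} (Ω : Set (EuclideanSpace ℝ (Fin n))) : ℝ :=
  sSup {t : ℝ | ∃ u : EuclideanSpace ℝ (Fin n) → ℝ,
    ContDiff ℝ (⊤ : ℕ∞) u ∧ HasCompactSupport u ∧ tsupport u ⊆ interior Ω ∧
    0 < (∫ x, ‖gradient u x‖ ^ 2) ∧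
    t = (∫ x, |u x|) ^ 2 / ∫ x, ‖gradient u x‖ ^ 2}

/-- Coordinates on a finite-dimensional space given by inner products with independent vectors. -/
theorem exists_linearEquiv_inner {E ι : Type*} [NormedAddCommGroup E] [InnerProductSpace ℝ E]
    [FiniteDimensional ℝ E] [Fintype ι] {w : ι → E} (hw : LinearIndependent ℝ w)
    (hcard : Fintype.card ι = Module.finrank ℝ E) :
    ∃ Φ : E ≃ₗ[ℝ] (ι → ℝ), ∀ x i, Φ x i = ⟪x, w i⟫ := by
  let L : E →ₗ[ℝ] (ι → ℝ) := LinearMap.pi fun i => (innerₗ E).flip (w i)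
  have hL : ∀ x i, L x i = ⟪x, w i⟫ := fun x i => by simp [L, real_inner_comm]
  have hinj : Function.Injective L := by
    rw [injective_iff_map_eq_zero]
    intro x hx
    have hspan := hw.span_eq_top_of_card_eq_finrank' hcard
    have hmem : x ∈ Submodule.span ℝ (Set.range w) := hspan ▸ Submodule.mem_top
    obtain ⟨c, hc⟩ := (Submodule.mem_span_range_iff_exists_fun ℝ).1 hmem
    have : ⟪x, x⟫ = 0 := by
      conv_lhs => rw [← hc, inner_sum]
      rw [hc]
      refine Finset.sum_eq_zero fun i _ => ?_
      rw [inner_smul_right, ← hL x i, hx]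
      simp
    exact inner_self_eq_zero.1 this
  refine ⟨LinearMap.linearEquivOfInjective L hinj (by simp [hcard]), fun x i => ?_⟩
  simp [hL]

/-- A simplex containing the origin, with fixed outer normals, has size controlled by any `r` such
that the simplex with facets moved inwards by `r` is empty. -/
theorem exists_norm_le_of_inner_parallel_empty {E ι : Type*} [NormedAddCommGroup E]
    [InnerProductSpace ℝ E] [FiniteDimensional ℝ E] [Fintype ι] [DecidableEq ι] {w : ι → E}
    (hw : LinearIndependent ℝ w) (hcard : Fintype.card ι = Module.finrank ℝ E) {c : ι → ℝ}
    (hc : ∀ i, c i ≠ 0) :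
    ∃ C : ℝ, ∀ (h : ι → ℝ) (h₀ r : ℝ), (∀ i, 0 ≤ h i) → 0 ≤ h₀ → 0 < r →
      (¬ ∃ x : E, (∀ i, ⟪x, w i⟫ ≤ h i - r) ∧ ⟪x, ∑ i, c i • w i⟫ ≤ h₀ - r) →
      ∀ x : E, (∀ i, ⟪x, w i⟫ ≤ h i) → ⟪x, ∑ i, c i • w i⟫ ≤ h₀ → ‖x‖ ≤ C * r := by
  obtain ⟨Φ, hΦ⟩ := exists_linearEquiv_inner hw hcard
  have hz : ∀ x : E, ⟪x, ∑ i, c i • w i⟫ = ∑ i, c i * Φ x i := fun x => by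
    simp [inner_sum, inner_smul_right, hΦ]
  simp only [← hΦ, hz]
  by_cases hneg : ∀ i, c i < 0
  · let Ψ : (ι → ℝ) →L[ℝ] E := LinearMap.toContinuousLinearMap Φ.symm.toLinearMap
    set D : ℝ := 1 + ∑ i, -c i with hD
    have hDpos : 0 < D := by
      have := Finset.sum_nonneg fun i (_ : i ∈ Finset.univ) => (neg_pos.2 (hneg i)).le
      linarith
    set M : ℝ := ∑ i, (-c i)⁻¹ with hM
    have hM0 : 0 ≤ M := Finset.sum_nonneg fun i _ => (inv_pos.2 (neg_pos.2 (hneg i))).le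
    refine ⟨‖Ψ‖ * (D * M), fun h h₀ r hh hh₀ hr hno x hx hx₀ => ?_⟩
    have hlt : ∑ i, -c i * h i + h₀ < r * D := by
      by_contra! hcon
      refine hno ⟨Φ.symm fun i => h i - r, by simp, ?_⟩
      simp only [LinearEquiv.apply_symm_apply, mul_sub, Finset.sum_sub_distrib]
      rw [hD, mul_add, Finset.mul_sum] at hcon
      simp only [neg_mul, Finset.sum_neg_distrib, mul_comm r] at hcon
      linarith
    have hcoord : ∀ j, |Φ x j| ≤ D * M * r := by
      intro j
      have hcj : 0 < -c j := neg_pos.2 (hneg j)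
      have h1 : -c j * h j ≤ ∑ i, -c i * h i :=
        Finset.single_le_sum (f := fun i => -c i * h i)
          (fun i _ => mul_nonneg (neg_pos.2 (hneg i)).le (hh i)) (Finset.mem_univ j)
      have h2 : -c j * (h j - Φ x j) ≤ ∑ i, -c i * (h i - Φ x i) :=
        Finset.single_le_sum (f := fun i => -c i * (h i - Φ x i))
          (fun i _ => mul_nonneg (neg_pos.2 (hneg i)).le (sub_nonneg.2 (hx i)))
          (Finset.mem_univ j)
      have h3 : ∑ i, -c i * (h i - Φ x i) = ∑ i, -c i * h i + ∑ i, c i * Φ x i := by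
        rw [← Finset.sum_add_distrib]
        exact Finset.sum_congr rfl fun i _ => by ring
      have h4 : (-c j)⁻¹ ≤ M :=
        Finset.single_le_sum (f := fun i => (-c i)⁻¹)
          (fun i _ => (inv_pos.2 (neg_pos.2 (hneg i))).le) (Finset.mem_univ j)
      have h5 : |-c j * Φ x j| ≤ r * D := by
        rw [abs_le]
        have := mul_nonneg hcj.le (hh j)
        have := mul_le_mul_of_nonneg_left (hx j) hcj.le
        constructor <;> nlinarith
      rw [abs_mul, abs_of_pos hcj] at h5
      calc |Φ x j| = (-c j)⁻¹ * (-c j * |Φ x j|) :=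
            (inv_mul_cancel_left₀ hcj.ne' _).symm
        _ ≤ M * (r * D) := mul_le_mul h4 h5 (by positivity) hM0
        _ = D * M * r := by ring
    calc ‖x‖ = ‖Ψ (Φ x)‖ := by simp [Ψ]
      _ ≤ ‖Ψ‖ * ‖Φ x‖ := Ψ.le_opNorm _
      _ ≤ ‖Ψ‖ * (D * M * r) := by
        gcongr
        exact (pi_norm_le_iff_of_nonneg (by positivity)).2 hcoord
      _ = ‖Ψ‖ * (D * M) * r := by ring
  · push Not at hneg
    obtain ⟨i, hi⟩ := hneg
    have hi : 0 < c i := lt_of_le_of_ne hi (hc i).symm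
    refine ⟨0, fun h h₀ r _ _ _ hno => (hno ?_).elim⟩
    set s : ℝ := |∑ j, c j * (h j - r) - (h₀ - r)| / c i with hs
    have hs0 : 0 ≤ s := by positivity
    refine ⟨Φ.symm ((fun j => h j - r) - Pi.single i s), fun j => ?_, ?_⟩
    · have : 0 ≤ (Pi.single i s : ι → ℝ) j := by
        by_cases hj : j = i
        · subst hj; simpa
        · simp [hj]
      simp only [LinearEquiv.apply_symm_apply, Pi.sub_apply]
      linarith
    · simp only [LinearEquiv.apply_symm_apply, Pi.sub_apply]
      have : ∑ j, c j * (h j - r - (Pi.single i s : ι → ℝ) j)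
          = ∑ j, c j * (h j - r) - c i * s := by
        simp only [mul_sub, Finset.sum_sub_distrib, Pi.single_apply, mul_ite, mul_zero,
          Finset.sum_ite_eq', Finset.mem_univ, if_true]
      rw [this, hs, mul_div_cancel₀ _ hi.ne']
      linarith [le_abs_self (∑ j, c j * (h j - r) - (h₀ - r))]

/-- For vectors in general position, every coefficient in the expansion of one of them with respect
to `n` others is nonzero. -/
theorem coeff_ne_zero_of_general_position {n : ℕ} {ι : Type*} [DecidableEq ι]
    {v : ι → EuclideanSpace ℝ (Fin n)}
    (hgen : ∀ s : Finset ι, s.card = n → LinearIndependent ℝ (fun i : s => v i))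
    {T : Finset ι} (hT : T.card = n) {k : ι} (hk : k ∉ T) {c : T → ℝ}
    (hc : ∑ i : T, c i • v i = v k) (i : T) : c i ≠ 0 := by
  intro hci
  obtain ⟨Φ, hΦ⟩ := exists_linearEquiv_inner (hgen T hT) (by simp [hT])
  set x := Φ.symm (Pi.single i 1) with hx
  have hxT : ∀ j : T, ⟪x, v j⟫ = (Pi.single i (1 : ℝ) : T → ℝ) j := fun j => by
    rw [← hΦ x j, hx, LinearEquiv.apply_symm_apply]
  have hkT : k ∉ T.erase i := fun h => hk (Finset.mem_of_mem_erase h)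
  have hT' : (insert k (T.erase i)).card = n := by
    rw [Finset.card_insert_of_notMem hkT, Finset.card_erase_of_mem i.2, hT]
    have : 0 < T.card := Finset.card_pos.2 ⟨i, i.2⟩
    omega
  obtain ⟨Φ', hΦ'⟩ := exists_linearEquiv_inner (hgen _ hT') (by simp [hT'])
  have hx0 : x = 0 := by
    rw [← Φ'.map_eq_zero_iff]
    funext j
    rw [hΦ']
    obtain ⟨j, hj⟩ := j
    rcases Finset.mem_insert.1 hj with rfl | hj
    · simp [← hc, inner_sum, inner_smul_right, hxT, Pi.single_apply, hci]
    · have hji := Finset.ne_of_mem_erase hj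
      have := hxT ⟨j, Finset.mem_of_mem_erase hj⟩
      simpa [Pi.single_apply, Subtype.ext_iff, hji] using this
  have := hxT i
  simp [hx0] at this

/-- If the normals are in general position, a polyhedron containing the origin with no inscribed
ball of radius `r` has size at most a multiple of `r`. -/
theorem exists_norm_le_of_no_inscribed_ball {n N : ℕ} (hN : n + 1 ≤ N)
    {v : Fin N → EuclideanSpace ℝ (Fin n)}
    (hgen : ∀ s : Finset (Fin N), s.card = n → LinearIndependent ℝ (fun i : s => v i)) :
    ∃ C : ℝ, ∀ (h : Fin N → ℝ) (r : ℝ), (∀ k, 0 ≤ h k) → 0 < r →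
      (¬ ∃ x, ∀ k, ⟪x, v k⟫ ≤ h k - r) → ∀ x, (∀ k, ⟪x, v k⟫ ≤ h k) → ‖x‖ ≤ C * r := by
  have key : ∀ S : Finset (Fin N), ∃ C : ℝ, S.card = n + 1 → ∀ (h : Fin N → ℝ) (r : ℝ),
      (∀ k, 0 ≤ h k) → 0 < r → (¬ ∃ x, ∀ k ∈ S, ⟪x, v k⟫ ≤ h k - r) →
      ∀ x, (∀ k, ⟪x, v k⟫ ≤ h k) → ‖x‖ ≤ C * r := by
    intro S
    by_cases hS : S.card = n + 1
    swap
    · exact ⟨0, fun h => (hS h).elim⟩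
    obtain ⟨k, T, hk, rfl, hT⟩ := Finset.card_eq_succ.1 hS
    have hli := hgen T hT
    have hcard : Fintype.card T = Module.finrank ℝ (EuclideanSpace ℝ (Fin n)) := by simp [hT]
    have hmem : v k ∈ Submodule.span ℝ (Set.range fun i : T => v i) :=
      hli.span_eq_top_of_card_eq_finrank' hcard ▸ Submodule.mem_top
    obtain ⟨c, hc⟩ := (Submodule.mem_span_range_iff_exists_fun ℝ).1 hmem
    obtain ⟨C, hC⟩ := exists_norm_le_of_inner_parallel_empty hli hcard
      (coeff_ne_zero_of_general_position hgen hT hk hc)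
    refine ⟨C, fun _ h r hh hr hno x hx => ?_⟩
    refine hC (fun i => h i) (h k) r (fun i => hh i) (hh k) hr ?_ x (fun i => hx i)
      (by rw [hc]; exact hx k)
    rintro ⟨y, hy, hyk⟩
    rw [hc] at hyk
    refine hno ⟨y, fun j hj => ?_⟩
    rcases Finset.mem_insert.1 hj with rfl | hj
    · exact hyk
    · exact hy ⟨j, hj⟩
  choose C hC using key
  obtain ⟨M, hM⟩ := (Set.finite_range C).bddAbove
  refine ⟨M, fun h r hh hr hno x hx => ?_⟩
  by_contra! hlarge
  have hconv : ∀ k ∈ (Finset.univ : Finset (Fin N)),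
      Convex ℝ {x : EuclideanSpace ℝ (Fin n) | ⟪x, v k⟫ ≤ h k - r} := by
    intro k _
    simp only [real_inner_comm (v k)]
    exact convex_halfSpace_le ((innerₗ (EuclideanSpace ℝ (Fin n)) (v k)).isLinear) _
  have hne := Convex.helly_theorem (𝕜 := ℝ) (s := Finset.univ) (by simpa using hN) hconv ?_
  · obtain ⟨y, hy⟩ := hne
    exact hno ⟨y, by simpa using hy⟩
  · intro S _ hS
    by_contra hempty
    have hS' : S.card = n + 1 := by simpa using hS
    have := hC S hS' h r hh hr
      (fun ⟨y, hy⟩ => hempty ⟨y, by simpa using hy⟩) x hx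
    have hle : C S * r ≤ M * r := mul_le_mul_of_nonneg_right (hM ⟨S, rfl⟩) hr.le
    linarith

/-- A Poincaré type inequality: the `L¹` norm of a smooth function supported in a bounded set is
controlled by the `L²` norm of its gradient. -/
theorem exists_sq_integral_abs_le {n : ℕ} (hn : 2 ≤ n) {Ω : Set (EuclideanSpace ℝ (Fin n))}
    (hΩ : IsCompact Ω) :
    ∃ C : ℝ, ∀ u : EuclideanSpace ℝ (Fin n) → ℝ, ContDiff ℝ (⊤ : ℕ∞) u →
      tsupport u ⊆ Ω → (∫ x, |u x|) ^ 2 ≤ C * ∫ x, ‖gradient u x‖ ^ 2 := by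
  set K : ℝ := ↑(eLpNormLESNormFDerivOfLeConst ℝ
    (volume : Measure (EuclideanSpace ℝ (Fin n))) Ω 1 1) with hK
  refine ⟨K ^ 2 * volume.real Ω, fun u hu hsupp => ?_⟩
  have hcs : HasCompactSupport u := hΩ.of_isClosed_subset (isClosed_tsupport u) hsupp
  have hu1 : ContDiff ℝ 1 u := hu.of_le (by exact_mod_cast le_top)
  have hgrad : ∀ x, ‖gradient u x‖ = ‖fderiv ℝ u x‖ := fun x => by simp [gradient]
  simp only [hgrad]
  have hdc : Continuous (fderiv ℝ u) := hu1.continuous_fderiv one_ne_zero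
  have hdcs : HasCompactSupport (fderiv ℝ u) := hcs.fderiv ℝ
  have hdsupp : Function.support (fderiv ℝ u) ⊆ Ω := (support_fderiv_subset ℝ).trans hsupp
  have hint : Integrable (fderiv ℝ u) := hdc.integrable_of_hasCompactSupport hdcs
  have huint : Integrable u := hu1.continuous.integrable_of_hasCompactSupport hcs
  have hsob : ∫ x, |u x| ≤ K * ∫ x, ‖fderiv ℝ u x‖ := by
    have := eLpNorm_le_eLpNorm_fderiv_of_le (F := ℝ)
      (volume : Measure (EuclideanSpace ℝ (Fin n))) hu1 ((subset_tsupport u).trans hsupp)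
      (p := 1) (q := 1) le_rfl (by simp; omega) (by simp) hΩ.isBounded
    simp only [ENNReal.coe_one, eLpNorm_one_eq_lintegral_enorm,
      ← ofReal_integral_norm_eq_lintegral_enorm huint,
      ← ofReal_integral_norm_eq_lintegral_enorm hint] at this
    rw [← ENNReal.ofReal_coe_nnreal, ← ENNReal.ofReal_mul NNReal.zero_le_coe] at this
    have := (ENNReal.ofReal_le_ofReal_iff
      (mul_nonneg NNReal.zero_le_coe (integral_nonneg fun _ => norm_nonneg _))).1 this
    simpa [hK] using this
  have hcauchy : (∫ x, ‖fderiv ℝ u x‖) ^ 2 ≤ volume.real Ω * ∫ x, ‖fderiv ℝ u x‖ ^ 2 := by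
    have hoff : ∀ x, x ∉ Ω → ‖fderiv ℝ u x‖ = 0 := fun x hx => by
      by_contra h
      exact hx (hdsupp (by simpa using h))
    have h1 : ∫ x, ‖fderiv ℝ u x‖ = ∫ x in Ω, ‖fderiv ℝ u x‖ :=
      (setIntegral_eq_integral_of_forall_compl_eq_zero hoff).symm
    have h2 : ∫ x, ‖fderiv ℝ u x‖ ^ 2 = ∫ x in Ω, ‖fderiv ℝ u x‖ ^ 2 :=
      (setIntegral_eq_integral_of_forall_compl_eq_zero fun x hx => by simp [hoff x hx]).symm
    have : IsFiniteMeasure (volume.restrict Ω) := ⟨by simpa using hΩ.measure_lt_top⟩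
    have hg : MemLp (fun x => ‖fderiv ℝ u x‖) (ENNReal.ofReal 2) (volume.restrict Ω) :=
      ((hdc.memLp_of_hasCompactSupport hdcs).norm).restrict Ω
    have := integral_mul_le_Lp_mul_Lq_of_nonneg (μ := volume.restrict Ω)
      Real.HolderConjugate.two_two (f := fun _ => (1 : ℝ)) (g := fun x => ‖fderiv ℝ u x‖)
      (.of_forall fun _ => zero_le_one) (.of_forall fun _ => norm_nonneg _) (memLp_const 1) hg
    simp only [one_mul, Real.rpow_two, one_pow, integral_const, smul_eq_mul, mul_one,
      measureReal_restrict_apply_univ, ← h1, ← h2, ← Real.sqrt_eq_rpow] at this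
    calc (∫ x, ‖fderiv ℝ u x‖) ^ 2
        ≤ (√(volume.real Ω) * √(∫ x, ‖fderiv ℝ u x‖ ^ 2)) ^ 2 :=
          pow_le_pow_left₀ (integral_nonneg fun _ => norm_nonneg _) this 2
      _ = _ := by
        rw [mul_pow, Real.sq_sqrt measureReal_nonneg,
          Real.sq_sqrt (integral_nonneg fun _ => by positivity)]
  calc (∫ x, |u x|) ^ 2 ≤ (K * ∫ x, ‖fderiv ℝ u x‖) ^ 2 :=
        pow_le_pow_left₀ (integral_nonneg fun _ => abs_nonneg _) hsob 2
    _ = K ^ 2 * (∫ x, ‖fderiv ℝ u x‖) ^ 2 := mul_pow _ _ _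
    _ ≤ K ^ 2 * (volume.real Ω * ∫ x, ‖fderiv ℝ u x‖ ^ 2) := by gcongr
    _ = _ := by ring

/-- Every admissible quotient bounds the torsional rigidity of a compact set from below. -/
theorem sq_div_le_torsion {n : ℕ} (hn : 2 ≤ n) {Ω : Set (EuclideanSpace ℝ (Fin n))}
    (hΩ : IsCompact Ω) {u : EuclideanSpace ℝ (Fin n) → ℝ} (hu : ContDiff ℝ (⊤ : ℕ∞) u)
    (hcs : HasCompactSupport u) (hsupp : tsupport u ⊆ interior Ω)
    (hpos : 0 < ∫ x, ‖gradient u x‖ ^ 2) :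
    (∫ x, |u x|) ^ 2 / ∫ x, ‖gradient u x‖ ^ 2 ≤ torsion Ω := by
  obtain ⟨C, hC⟩ := exists_sq_integral_abs_le hn hΩ
  refine le_csSup ⟨C, ?_⟩ ⟨u, hu, hcs, hsupp, hpos, rfl⟩
  rintro t ⟨w, hw, -, hws, hwpos, rfl⟩
  exact (div_le_iff₀ hwpos).2 (hC w hw (hws.trans interior_subset))

/-- The torsional rigidity of a compact set containing a ball of radius `r` is at least a fixed
multiple of `r ^ (n + 2)`. -/
theorem exists_pos_mul_pow_le_torsion {n : ℕ} (hn : 2 ≤ n) :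
    ∃ t : ℝ, 0 < t ∧ ∀ (Ω : Set (EuclideanSpace ℝ (Fin n))) (c : EuclideanSpace ℝ (Fin n))
      (r : ℝ), IsCompact Ω → 0 < r → Metric.closedBall c r ⊆ Ω →
      t * r ^ (n + 2) ≤ torsion Ω := by
  let f : ContDiffBump (0 : EuclideanSpace ℝ (Fin n)) := ⟨1 / 4, 1 / 2, by norm_num, by norm_num⟩
  have hf : ContDiff ℝ (⊤ : ℕ∞) f := f.contDiff
  have habs : 0 < ∫ x, |f x| := by
    simpa only [abs_of_nonneg f.nonneg] using f.integral_pos (μ := volume)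
  have hgpos : 0 < ∫ x, ‖gradient f x‖ ^ 2 := by
    obtain ⟨C, hC⟩ := exists_sq_integral_abs_le hn
      (isCompact_closedBall (0 : EuclideanSpace ℝ (Fin n)) (1 / 2))
    have h1 := hC f hf f.tsupport_eq.subset
    have h2 : 0 ≤ ∫ x, ‖gradient f x‖ ^ 2 := integral_nonneg fun _ => by positivity
    refine h2.lt_of_ne fun h => ?_
    rw [← h, mul_zero] at h1
    exact absurd h1 (not_le.2 (by positivity))
  refine ⟨(∫ x, |f x|) ^ 2 / ∫ x, ‖gradient f x‖ ^ 2, by positivity,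
    fun Ω c r hΩ hr hball => ?_⟩
  let u : EuclideanSpace ℝ (Fin n) → ℝ := fun x => f (r⁻¹ • (x - c))
  have hu : ContDiff ℝ (⊤ : ℕ∞) u :=
    hf.comp ((contDiff_id.sub contDiff_const).const_smul r⁻¹)
  have hsupp : tsupport u ⊆ Metric.closedBall c (r / 2) := by
    refine closure_minimal (fun x hx => ?_) Metric.isClosed_closedBall
    have : r⁻¹ • (x - c) ∈ Function.support f := hx
    rw [f.support_eq, mem_ball_zero_iff, norm_smul, Real.norm_of_nonneg (inv_pos.2 hr).le] at this
    rw [mem_closedBall_iff_norm]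
    have h2 : r⁻¹ * ‖x - c‖ < 1 / 2 := this
    rw [inv_mul_lt_iff₀ hr] at h2
    linarith
  have hcs : HasCompactSupport u :=
    (isCompact_closedBall c (r / 2)).of_isClosed_subset (isClosed_tsupport u) hsupp
  have hsuppΩ : tsupport u ⊆ interior Ω :=
    (hsupp.trans (Metric.closedBall_subset_ball (half_lt_self hr))).trans
      (interior_maximal (Metric.ball_subset_closedBall.trans hball) Metric.isOpen_ball)
  have hgrad : ∀ x, ‖gradient u x‖ ^ 2 = r⁻¹ ^ 2 * ‖gradient f (r⁻¹ • (x - c))‖ ^ 2 := by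
    intro x
    have : fderiv ℝ u x = r⁻¹ • fderiv ℝ f (r⁻¹ • (x - c)) := by
      change fderiv ℝ (fun y => (fun z => f (r⁻¹ • z)) (y - c)) x = _
      rw [fderiv_comp_sub (f := fun z => f (r⁻¹ • z)), fderiv_comp_smul]
    simp only [gradient, LinearIsometryEquiv.norm_map, this, norm_smul, mul_pow]
    simp
  have hscale : ∀ g : EuclideanSpace ℝ (Fin n) → ℝ,
      ∫ x, g (r⁻¹ • (x - c)) = r ^ n * ∫ x, g x := by
    intro g
    rw [integral_sub_right_eq_self (fun x => g (r⁻¹ • x)) c,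
      Measure.integral_comp_inv_smul_of_nonneg _ _ hr.le]
    simp
  have h1 : ∫ x, |u x| = r ^ n * ∫ x, |f x| := hscale fun x => |f x|
  have h2 : ∫ x, ‖gradient u x‖ ^ 2 = r⁻¹ ^ 2 * (r ^ n * ∫ x, ‖gradient f x‖ ^ 2) := by
    simp only [hgrad]
    rw [integral_const_mul, hscale fun x => ‖gradient f x‖ ^ 2]
  have := sq_div_le_torsion hn hΩ hu hcs hsuppΩ (by rw [h2]; positivity)
  refine le_of_eq_of_le ?_ this
  rw [h1, h2]
  field_simp
  ring

theorem general_position_unbounded_outer_radius_implies_unbounded_torsion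
    {n N : ℕ} (hn : 2 ≤ n) (hN : n + 1 ≤ N)
    (v : Fin N → EuclideanSpace ℝ (Fin n)) (hv : ∀ k, ‖v k‖ = 1)
    (hhemi : ∀ u : EuclideanSpace ℝ (Fin n), ‖u‖ = 1 → ∃ k, 0 < ⟪v k, u⟫)
    (hgen : ∀ s : Finset (Fin N), s.card = n →
      LinearIndependent ℝ (fun i : s => v i))
    (P : ℕ → Set (EuclideanSpace ℝ (Fin n)))
    (hPcpt : ∀ i, IsCompact (P i)) (hPconv : ∀ i, Convex ℝ (P i))
    (hPint : ∀ i, (interior (P i)).Nonempty)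
    (hPfacets : ∀ i, P i = ⋂ k, {x | ⟪x, v k⟫ ≤ supportFn (P i) (v k)})
    (hout : ¬ ∃ M : ℝ, ∀ i, outerRadius (P i) ≤ M) :
    ¬ ∃ M : ℝ, ∀ i, torsion (P i) ≤ M := by
  rintro ⟨M, hM⟩
  obtain ⟨t, ht, htor⟩ := exists_pos_mul_pow_le_torsion hn
  obtain ⟨C, hC⟩ := exists_norm_le_of_no_inscribed_ball hN hgen
  set r : ℝ := 1 + |M| / t with hr
  have hr1 : 1 ≤ r := by
    have : 0 ≤ |M| / t := by positivity
    linarith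
  have hr0 : 0 < r := by linarith
  refine hout ⟨max 1 (C * r), fun i => ?_⟩
  have hmem : ∀ x, x ∈ P i ↔ ∀ k, ⟪x, v k⟫ ≤ supportFn (P i) (v k) := fun x => by
    conv_lhs => rw [hPfacets i]
    simp
  obtain ⟨p, hp⟩ := (hPint i).mono interior_subset
  set h : Fin N → ℝ := fun k => supportFn (P i) (v k) - ⟪p, v k⟫ with hh
  have hno : ¬ ∃ x, ∀ k, ⟪x, v k⟫ ≤ h k - r := by
    rintro ⟨x, hx⟩
    have hball : Metric.closedBall (p + x) r ⊆ P i := by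
      intro y hy
      rw [mem_closedBall_iff_norm] at hy
      refine (hmem y).2 fun k => ?_
      have h1 : ⟪y - (p + x), v k⟫ ≤ r := by
        refine (real_inner_le_norm _ _).trans ?_
        rwa [hv k, mul_one]
      have h2 := hx k
      simp only [hh] at h2
      rw [inner_sub_left, inner_add_left] at h1
      linarith
    have h1 := (htor _ _ r (hPcpt i) hr0 hball).trans (hM i)
    have h2 : r ≤ r ^ (n + 2) := le_self_pow₀ hr1 (by omega)
    have h3 : t * r ≤ t * r ^ (n + 2) := mul_le_mul_of_nonneg_left h2 ht.le
    have h4 : t * r = t + |M| := by rw [hr]; field_simp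
    linarith [le_abs_self M]
  refine csInf_le ⟨0, fun R hR => hR.1.le⟩ ⟨lt_max_of_lt_left one_pos, p, fun y hy => ?_⟩
  rw [mem_closedBall_iff_norm]
  refine (hC h r (fun k => sub_nonneg.2 ((hmem p).1 hp k)) hr0 hno (y - p) fun k => ?_).trans
    (le_max_right _ _)
  rw [inner_sub_left]
  exact sub_le_sub_right ((hmem y).1 hy k) _
end

section
/- Let n ≥ 2 and let μ be a nonzero finite Borel measure on S^{n−1} satisfying the subspace mass inequality. Let (μ̄_j) be a sequence of finite Borel measures on S^{n−1} with μ̄_j(S^{n−1}) = μ(S^{n−1}) for every j, converging weakly to μ. Then there exist N₀ > 0, η₀ ∈ (0,1), and for each k = 1, …, n−1 a constant χ̃_k ∈ (0, k/n), such that for all j > N₀, μ̄_j(R_{η₀}(ξ ∩ S^{n−1})) / μ(S^{n−1}) < χ̃_k for every k-dimensional linear subspace ξ ⊆ ℝⁿ and every k = 1, …, n−1. -/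
open MeasureTheory Filter

open Topology

section UniformPortmanteau

variable {X Y : Type*} [PseudoMetricSpace X] [MeasurableSpace X] [BorelSpace X]
  [TopologicalSpace Y]

/-- If the integrals of all continuous functions converge, then strict upper bounds on the measure
of a closed set persist along the sequence. -/
theorem eventually_measure_lt_of_isClosed (μ : Measure X) [IsFiniteMeasure μ] (ν : ℕ → Measure X)
    [∀ j, IsFiniteMeasure (ν j)]
    (hweak : ∀ f : X → ℝ, Continuous f →
      Tendsto (fun j => ∫ x, f x ∂(ν j)) atTop (𝓝 (∫ x, f x ∂μ)))
    {F : Set X} (hF : IsClosed F) {c : ENNReal} (hc : μ F < c) :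
    ∀ᶠ j in atTop, ν j F < c := by
  let μ' : FiniteMeasure X := ⟨μ, inferInstance⟩
  let ν' : ℕ → FiniteMeasure X := fun j => ⟨ν j, inferInstance⟩
  have hlim : Tendsto ν' atTop (𝓝 μ') :=
    FiniteMeasure.tendsto_iff_forall_integral_tendsto.2 fun f => hweak f f.continuous
  exact eventually_lt_of_limsup_lt
    ((FiniteMeasure.limsup_measure_closed_le_of_tendsto hlim hF).trans_lt hc)

theorem eventually_measure_sublevel_lt (μ : Measure X) [IsFiniteMeasure μ] {g : X → ℝ}
    (hg : Continuous g) {c : ENNReal} (hc : μ {x | g x ≤ 0} < c) :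
    ∀ᶠ r in 𝓝[>] (0 : ℝ), μ {x | g x ≤ r} < c := by
  have hInter : ⋂ r > (0 : ℝ), {x | g x ≤ r} = {x | g x ≤ 0} := by
    ext x
    simpa using ⟨fun h => le_of_forall_gt_imp_ge_of_dense h, fun h r hr => h.trans hr.le⟩
  have hlim := tendsto_measure_biInter_gt (μ := μ) (s := fun r : ℝ => {x | g x ≤ r}) (a := 0)
    (fun r _ => (isClosed_le hg continuous_const).measurableSet.nullMeasurableSet)
    (fun _ _ _ hij _ hx => le_trans hx hij) ⟨1, one_pos, measure_ne_top _ _⟩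
  rw [hInter] at hlim
  exact hlim.eventually_lt_const hc

/-- A version of the closed-set half of the portmanteau theorem that is uniform over a compact
family of sets `{x | G y x ≤ 0}` and stable under small enlargements of these sets. -/
theorem exists_lt_eventually_forall_measure_sublevel_le [CompactSpace X]
    (μ : Measure X) [IsFiniteMeasure μ] (ν : ℕ → Measure X) [∀ j, IsFiniteMeasure (ν j)]
    (hweak : ∀ f : X → ℝ, Continuous f →
      Tendsto (fun j => ∫ x, f x ∂(ν j)) atTop (𝓝 (∫ x, f x ∂μ)))
    {K : Set Y} (hK : IsCompact K) {G : Y → X → ℝ} (hG : Continuous fun p : Y × X => G p.1 p.2)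
    {L : ENNReal} (hL : 0 < L) (hlt : ∀ y ∈ K, μ {x | G y x ≤ 0} < L) :
    ∃ c < L, ∀ᶠ η in 𝓝[>] (0 : ℝ), ∀ᶠ j in atTop, ∀ y ∈ K, ν j {x | G y x < η} ≤ c := by
  refine hK.induction_on
    (p := fun s => ∃ c < L, ∀ᶠ η in 𝓝[>] (0 : ℝ), ∀ᶠ j in atTop, ∀ y ∈ s, ν j {x | G y x < η} ≤ c)
    ⟨0, hL, by simp⟩ ?_ ?_ ?_
  · rintro s t hst ⟨c, hc, h⟩
    exact ⟨c, hc, h.mono fun η hη => hη.mono fun j hj y hy => hj y (hst hy)⟩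
  · rintro s t ⟨c, hc, h⟩ ⟨d, hd, h'⟩
    refine ⟨max c d, max_lt hc hd, ?_⟩
    filter_upwards [h, h'] with η hη hη'
    filter_upwards [hη, hη'] with j hj hj'
    rintro y (hy | hy)
    · exact (hj y hy).trans (le_max_left _ _)
    · exact (hj' y hy).trans (le_max_right _ _)
  · intro y hy
    obtain ⟨c, hyc, hc⟩ := exists_between (hlt y hy)
    have hGy : Continuous (G y) := hG.comp (Continuous.prodMk_right y)
    obtain ⟨r, hr, hr0⟩ :=
      ((eventually_measure_sublevel_lt μ hGy hyc).and self_mem_nhdsWithin).exists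
    have hr0 : 0 < r := hr0
    have hnear : ∀ᶠ y' in 𝓝 y, ∀ x ∈ (Set.univ : Set X), G y x - G y' x < r / 2 := by
      refine isCompact_univ.eventually_forall_of_forall_eventually fun x _ => ?_
      have hcont : Continuous fun p : Y × X => G y p.2 - G p.1 p.2 :=
        (hGy.comp continuous_snd).sub hG
      exact hcont.continuousAt.eventually_lt_const (by simpa using half_pos hr0)
    refine ⟨_, mem_nhdsWithin_of_mem_nhds hnear, c, hc, ?_⟩
    filter_upwards [Ioo_mem_nhdsGT (half_pos hr0)] with η hη
    filter_upwards [eventually_measure_lt_of_isClosed μ ν hweak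
      (isClosed_le hGy continuous_const) hr] with j hj y' hy'
    refine (measure_mono fun x hx => ?_).trans hj.le
    have h₁ : G y' x < η := hx
    have h₂ := hy' x trivial
    have h₃ := hη.2
    change G y x ≤ r
    linarith

end UniformPortmanteau

section Projections

variable {E : Type*} [NormedAddCommGroup E] [InnerProductSpace ℝ E]

/-- The contractive projections of rank `k`. -/
def contractiveProjections (E : Type*) [NormedAddCommGroup E] [InnerProductSpace ℝ E] (k : ℕ) :
    Set (E →L[ℝ] E) :=
  {P | IsIdempotentElem P ∧ ‖P‖ ≤ 1 ∧ LinearMap.trace ℝ E P = k}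

variable [FiniteDimensional ℝ E]

theorem trace_eq_finrank_range {P : E →L[ℝ] E} (hP : IsIdempotentElem P) :
    LinearMap.trace ℝ E P = Module.finrank ℝ P.range :=
  LinearMap.IsProj.trace (LinearMap.IsIdempotentElem.isProj_range _ (ContinuousLinearMap.IsIdempotentElem.toLinearMap hP))

theorem isCompact_contractiveProjections (k : ℕ) : IsCompact (contractiveProjections E k) := by
  have : ProperSpace (E →L[ℝ] E) := FiniteDimensional.proper ℝ _
  refine Metric.isCompact_of_isClosed_isBounded ?_ ?_
  · have htr : Continuous fun P : E →L[ℝ] E => LinearMap.trace ℝ E P :=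
      ((LinearMap.trace ℝ E).comp
        (ContinuousLinearMap.coeLM ℝ)).continuous_of_finiteDimensional
    exact (isClosed_eq (continuous_id.mul continuous_id) continuous_id).inter
      ((isClosed_le continuous_norm continuous_const).inter (isClosed_eq htr continuous_const))
  · exact isBounded_iff_forall_norm_le.2 ⟨1, fun P hP => hP.2.1⟩

theorem starProjection_mem_contractiveProjections (ξ : Submodule ℝ E) :
    ξ.starProjection ∈ contractiveProjections E (Module.finrank ℝ ξ) := by
  refine ⟨ξ.isIdempotentElem_starProjection, ξ.starProjection_norm_le, ?_⟩
  rw [trace_eq_finrank_range ξ.isIdempotentElem_starProjection, ξ.range_starProjection]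

theorem norm_sub_starProjection_le (ξ : Submodule ℝ E) (x : E) {u : E} (hu : u ∈ ξ) :
    ‖x - ξ.starProjection x‖ ≤ ‖x - u‖ := by
  rw [Submodule.starProjection_minimal]
  exact ciInf_le ⟨0, by rintro _ ⟨v, rfl⟩; positivity⟩ (⟨u, hu⟩ : ξ)

end Projections

theorem strengthened_subspace_mass_inequality
    {n : ℕ} (hn : 2 ≤ n)
    (μ : Measure ↥(Metric.sphere (0 : EuclideanSpace ℝ (Fin n)) 1))
    [IsFiniteMeasure μ] (hμne : μ ≠ 0)
    (hsmi : ∀ k : ℕ, 1 ≤ k → k ≤ n - 1 →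
      ∀ ξ : Submodule ℝ (EuclideanSpace ℝ (Fin n)), Module.finrank ℝ ξ = k →
        (μ {x | (x : EuclideanSpace ℝ (Fin n)) ∈ ξ}).toReal <
          ((k : ℝ) / n) * (μ Set.univ).toReal)
    (μbar : ℕ → Measure ↥(Metric.sphere (0 : EuclideanSpace ℝ (Fin n)) 1))
    (hmass : ∀ j, (μbar j) Set.univ = μ Set.univ)
    (hweak : ∀ f : ↥(Metric.sphere (0 : EuclideanSpace ℝ (Fin n)) 1) → ℝ, Continuous f →
      Tendsto (fun j => ∫ x, f x ∂(μbar j)) atTop (nhds (∫ x, f x ∂μ))) :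
    ∃ N₀ : ℕ, ∃ η₀ ∈ Set.Ioo (0 : ℝ) 1, ∃ χ : ℕ → ℝ,
      (∀ k : ℕ, 1 ≤ k → k ≤ n - 1 → χ k ∈ Set.Ioo (0 : ℝ) ((k : ℝ) / n)) ∧
      ∀ j > N₀, ∀ k : ℕ, 1 ≤ k → k ≤ n - 1 →
        ∀ ξ : Submodule ℝ (EuclideanSpace ℝ (Fin n)), Module.finrank ℝ ξ = k →
          ((μbar j) {x | ∃ u : EuclideanSpace ℝ (Fin n), u ∈ ξ ∧ ‖u‖ = 1 ∧
              ‖(x : EuclideanSpace ℝ (Fin n)) - u‖ < η₀}).toReal / (μ Set.univ).toReal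
            < χ k := by
  have hfin : ∀ j, IsFiniteMeasure (μbar j) := fun j => ⟨by
    rw [hmass]; exact measure_lt_top _ _⟩
  set M : ℝ := (μ Set.univ).toReal with hM
  have hMpos : 0 < M :=
    ENNReal.toReal_pos (Measure.measure_univ_ne_zero.2 hμne) (measure_ne_top _ _)
  have hn0 : (0 : ℝ) < n := by exact_mod_cast (by omega : 0 < n)
  have key : ∀ k ∈ Finset.Icc 1 (n - 1), ∃ c < ENNReal.ofReal (k / n * M),
      ∀ᶠ η in 𝓝[>] (0 : ℝ), ∀ᶠ j in atTop,
        ∀ P ∈ contractiveProjections (EuclideanSpace ℝ (Fin n)) k,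
          μbar j {x | ‖(x : EuclideanSpace ℝ (Fin n)) - P x‖ < η} ≤ c := by
    intro k hk
    rw [Finset.mem_Icc] at hk
    have hk0 : (0 : ℝ) < k := by exact_mod_cast hk.1
    refine exists_lt_eventually_forall_measure_sublevel_le μ μbar hweak
      (isCompact_contractiveProjections k)
      (G := fun (P : EuclideanSpace ℝ (Fin n) →L[ℝ] EuclideanSpace ℝ (Fin n))
          (x : Metric.sphere (0 : EuclideanSpace ℝ (Fin n)) 1) =>
        ‖(x : EuclideanSpace ℝ (Fin n)) - P x‖) (by fun_prop)
      (ENNReal.ofReal_pos.2 (by positivity)) fun P hP => ?_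
    rw [ENNReal.lt_ofReal_iff_toReal_lt (measure_ne_top _ _)]
    have hrank : Module.finrank ℝ P.range = k := by
      exact_mod_cast (trace_eq_finrank_range hP.1).symm.trans hP.2.2
    refine lt_of_le_of_lt (ENNReal.toReal_mono (measure_ne_top _ _) (measure_mono fun x hx => ?_))
      (hsmi k hk.1 hk.2 P.range hrank)
    have hx : ‖(x : EuclideanSpace ℝ (Fin n)) - P x‖ ≤ 0 := hx
    exact ⟨x, (sub_eq_zero.1 (norm_le_zero_iff.1 hx)).symm⟩
  choose! c hcL hc using key
  obtain ⟨η, hη, hη01⟩ := (((Finset.eventually_all _).2 hc).and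
    (Ioo_mem_nhdsGT one_pos)).exists
  obtain ⟨N, hN⟩ := eventually_atTop.1 ((Finset.eventually_all _).2 hη)
  have hcM : ∀ k ∈ Finset.Icc 1 (n - 1), (c k).toReal / M < k / n := fun k hk => by
    rw [div_lt_iff₀ hMpos]
    exact (ENNReal.lt_ofReal_iff_toReal_lt (hcL k hk).ne_top).1 (hcL k hk)
  have hc0 : ∀ k, 0 ≤ (c k).toReal / M := fun k => by positivity
  refine ⟨N, η, hη01, fun k => ((c k).toReal / M + k / n) / 2, fun k h₁ h₂ => ?_,
    fun j hj k h₁ h₂ ξ hξ => ?_⟩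
  · have hlt := hcM k (Finset.mem_Icc.2 ⟨h₁, h₂⟩)
    have := hc0 k
    constructor <;> linarith
  · have hk := Finset.mem_Icc.2 ⟨h₁, h₂⟩
    have hlt := hcM k hk
    have hle := hN j hj.le k hk ξ.starProjection
      (hξ ▸ starProjection_mem_contractiveProjections ξ)
    refine lt_of_le_of_lt (div_le_div_of_nonneg_right (ENNReal.toReal_mono (hcL k hk).ne_top
      ((measure_mono ?_).trans hle)) hMpos.le) (by linarith : (c k).toReal / M < _)
    rintro x ⟨u, hu, -, hxu⟩
    exact (norm_sub_starProjection_le ξ x hu).trans_lt hxu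
end

section
/- Let n ≥ 2 and ε₀ > 0. For j = 1, 2, …, let (e_{1,j}, …, e_{n,j}) be ordered orthonormal bases of ℝⁿ converging (componentwise) to an ordered orthonormal basis (e₁, …, e_n), and let 0 < a_{1,j} ≤ a_{2,j} ≤ … ≤ a_{n,j} with a_{n,j} ≥ ε₀. Let E_j = {x ∈ ℝⁿ : Σ_{k=1}^n (x·e_{k,j})²/a_{k,j}² ≤ 1}. Let μ be a nonzero finite Borel measure on S^{n−1} satisfying the subspace mass inequality, and let (μ̄_j) be finite Borel measures on S^{n−1} with μ̄_j(S^{n−1}) = μ(S^{n−1}) converging weakly to μ. Then there exist δ₀, t₀ ∈ (0,1) and N₀ > 0 such that for every j > N₀: (1/μ̄_j(S^{n−1})) ∫_{S^{n−1}} log h(E_j, v) dμ̄_j(v) ≥ log(δ₀/2) + t₀ log a_{n,j} + ((1−t₀)/n) log vol(E_j) − ((1−t₀)/n) log ω_n, where vol denotes Lebesgue measure on ℝⁿ and ω_n = vol(Bⁿ) is the volume of the unit ball. -/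
open scoped RealInnerProductSpace
open MeasureTheory Filter

section Ellipsoid

variable {n : ℕ} (b : OrthonormalBasis (Fin n) ℝ (EuclideanSpace ℝ (Fin n)))

theorem exists_orthonormalBasis_coe_eq {e : Fin n → EuclideanSpace ℝ (Fin n)}
    (he : Orthonormal ℝ e) :
    ∃ b : OrthonormalBasis (Fin n) ℝ (EuclideanSpace ℝ (Fin n)), ⇑b = e := by
  refine ⟨OrthonormalBasis.mk he ?_, OrthonormalBasis.coe_mk _ _⟩
  rw [he.linearIndependent.span_eq_top_of_card_eq_finrank' (by simp)]

theorem exists_inner_ne_zero {x : EuclideanSpace ℝ (Fin n)} (hx : x ≠ 0) :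
    ∃ k, ⟪x, b k⟫ ≠ 0 := by
  by_contra! h
  have := b.sum_sq_inner_left x
  simp only [h, zero_pow two_ne_zero, Finset.sum_const_zero] at this
  exact pow_ne_zero 2 (norm_ne_zero_iff.2 hx) this.symm

/-- The support function of an ellipsoid with axes `b k` and semiaxes `a k`. -/
theorem supportFn_ellipsoid {a : Fin n → ℝ} (ha : ∀ k, 0 < a k)
    {x : EuclideanSpace ℝ (Fin n)} (hx : x ≠ 0) :
    supportFn {y | ∑ k, ⟪y, b k⟫ ^ 2 / a k ^ 2 ≤ 1} x = √(∑ k, a k ^ 2 * ⟪x, b k⟫ ^ 2) := by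
  set S := ∑ k, a k ^ 2 * ⟪x, b k⟫ ^ 2 with hS
  have hS0 : 0 < S := by
    obtain ⟨k, hk⟩ := exists_inner_ne_zero b hx
    exact Finset.sum_pos' (fun _ _ => by positivity)
      ⟨k, Finset.mem_univ _, mul_pos (pow_pos (ha k) 2) (by positivity)⟩
  have hS' : 0 < √S := Real.sqrt_pos.2 hS0
  refine IsGreatest.csSup_eq ⟨⟨∑ k, (a k ^ 2 * ⟪x, b k⟫ / √S) • b k, ?_, ?_⟩, ?_⟩
  · have hcoord : ∀ k, ⟪∑ l, (a l ^ 2 * ⟪x, b l⟫ / √S) • b l, b k⟫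
        = a k ^ 2 * ⟪x, b k⟫ / √S := fun k => by
      simpa using b.orthonormal.inner_left_fintype (fun l => a l ^ 2 * ⟪x, b l⟫ / √S) k
    simp only [Set.mem_ofPred_eq, hcoord]
    have : ∀ k, (a k ^ 2 * ⟪x, b k⟫ / √S) ^ 2 / a k ^ 2 = a k ^ 2 * ⟪x, b k⟫ ^ 2 / S := by
      intro k
      have := (ha k).ne'
      rw [div_pow, Real.sq_sqrt hS0.le]
      field_simp
    simp only [this, ← Finset.sum_div]
    rw [← hS, div_self hS0.ne']
  · simp only [inner_sum, inner_smul_right]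
    have : ∀ k, a k ^ 2 * ⟪x, b k⟫ / √S * ⟪x, b k⟫ = a k ^ 2 * ⟪x, b k⟫ ^ 2 / √S :=
      fun k => by ring
    simp only [this, ← Finset.sum_div]
    rw [← hS, Real.div_sqrt]
  · rintro _ ⟨y, hy, rfl⟩
    refine Real.le_sqrt_of_sq_le ?_
    have hxy : ⟪x, y⟫ = ∑ k, (a k * ⟪x, b k⟫) * (⟪y, b k⟫ / a k) := by
      rw [← b.sum_inner_mul_inner x y]
      refine Finset.sum_congr rfl fun k _ => ?_
      have := (ha k).ne'
      rw [real_inner_comm y (b k)]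
      field_simp
    calc ⟪x, y⟫ ^ 2
        ≤ (∑ k, (a k * ⟪x, b k⟫) ^ 2) * ∑ k, (⟪y, b k⟫ / a k) ^ 2 := by
          rw [hxy]; exact Finset.sum_mul_sq_le_sq_mul_sq _ _ _
      _ = S * ∑ k, ⟪y, b k⟫ ^ 2 / a k ^ 2 := by simp only [mul_pow, div_pow, hS]
      _ ≤ S := mul_le_of_le_one_right hS0.le hy

theorem mul_abs_inner_le_supportFn_ellipsoid {a : Fin n → ℝ} (ha : ∀ k, 0 < a k)
    {x : EuclideanSpace ℝ (Fin n)} (hx : x ≠ 0) (k : Fin n) :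
    a k * |⟪x, b k⟫| ≤ supportFn {y | ∑ k, ⟪y, b k⟫ ^ 2 / a k ^ 2 ≤ 1} x := by
  rw [supportFn_ellipsoid b ha hx]
  refine Real.le_sqrt_of_sq_le ?_
  rw [mul_pow, sq_abs]
  exact Finset.single_le_sum (f := fun k => a k ^ 2 * ⟪x, b k⟫ ^ 2)
    (fun _ _ => by positivity) (Finset.mem_univ k)

theorem continuous_log_supportFn_ellipsoid {a : Fin n → ℝ} (ha : ∀ k, 0 < a k) :
    Continuous fun x : Metric.sphere (0 : EuclideanSpace ℝ (Fin n)) 1 =>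
      Real.log (supportFn {y | ∑ k, ⟪y, b k⟫ ^ 2 / a k ^ 2 ≤ 1} x) := by
  have hne : ∀ x : Metric.sphere (0 : EuclideanSpace ℝ (Fin n)) 1,
      (x : EuclideanSpace ℝ (Fin n)) ≠ 0 := fun x => ne_zero_of_mem_unit_sphere x
  refine Continuous.log ?_ fun x => ?_
  · simp only [supportFn_ellipsoid b ha (hne _)]
    fun_prop
  · obtain ⟨k, hk⟩ := exists_inner_ne_zero b (hne x)
    exact ((mul_pos (ha k) (abs_pos.2 hk)).trans_le
      (mul_abs_inner_le_supportFn_ellipsoid b ha (hne x) k)).ne'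

theorem volume_ellipsoid {a : Fin n → ℝ} (ha : ∀ k, 0 < a k) :
    volume {y | ∑ k, ⟪y, b k⟫ ^ 2 / a k ^ 2 ≤ 1} =
      ENNReal.ofReal (∏ k, a k) *
        volume (Metric.closedBall (0 : EuclideanSpace ℝ (Fin n)) 1) := by
  set T := Matrix.toLin b.toBasis b.toBasis (Matrix.diagonal fun k => (a k)⁻¹) with hT
  have hdet : LinearMap.det T = ∏ k, (a k)⁻¹ := by
    rw [hT, LinearMap.det_toLin, Matrix.det_diagonal]
  have hprod : 0 < ∏ k, a k := Finset.prod_pos fun k _ => ha k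
  have hcoord : ∀ y k, ⟪b k, T y⟫ = (a k)⁻¹ * ⟪b k, y⟫ := fun y k => by
    rw [← b.repr_apply_apply, ← b.repr_apply_apply, ← b.coe_toBasis_repr_apply,
      ← b.coe_toBasis_repr_apply, hT, Matrix.toLin_apply]
    simp [Matrix.mulVec_diagonal]
  have hE : {y | ∑ k, ⟪y, b k⟫ ^ 2 / a k ^ 2 ≤ 1} =
      T ⁻¹' Metric.closedBall (0 : EuclideanSpace ℝ (Fin n)) 1 := by
    ext y
    rw [Set.mem_preimage, mem_closedBall_zero_iff, ← sq_le_one_iff₀ (norm_nonneg _),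
      ← b.sum_sq_inner_right]
    simp only [hcoord, Set.mem_ofPred_eq, real_inner_comm (b _) y, mul_pow, inv_pow]
    simp only [div_eq_inv_mul]
  rw [Finset.prod_inv_distrib] at hdet
  rw [hE, Measure.addHaar_preimage_linearMap _ (by rw [hdet]; exact (inv_pos.2 hprod).ne'), hdet,
    inv_inv, abs_of_pos hprod]

theorem log_volume_ellipsoid {a : Fin n → ℝ} (ha : ∀ k, 0 < a k) :
    Real.log (volume {y | ∑ k, ⟪y, b k⟫ ^ 2 / a k ^ 2 ≤ 1}).toReal =
      ∑ k, Real.log (a k) +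
        Real.log (volume (Metric.closedBall (0 : EuclideanSpace ℝ (Fin n)) 1)).toReal := by
  have hprod : 0 < ∏ k, a k := Finset.prod_pos fun k _ => ha k
  have hball : 0 < (volume (Metric.closedBall (0 : EuclideanSpace ℝ (Fin n)) 1)).toReal :=
    ENNReal.toReal_pos (Metric.measure_closedBall_pos _ _ one_pos).ne'
      measure_closedBall_lt_top.ne
  rw [volume_ellipsoid b ha, ENNReal.toReal_mul, ENNReal.toReal_ofReal hprod.le,
    Real.log_mul hprod.ne' hball.ne', Real.log_prod fun k _ => (ha k).ne']

end Ellipsoid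

section Summation

theorem sum_range_succ_eq_mul_sub_sum (c : ℕ → ℝ) (p : ℕ) :
    ∑ k ∈ Finset.range (p + 1), c k =
      (p + 1) * c p - ∑ m ∈ Finset.range p, (m + 1) * (c (m + 1) - c m) := by
  induction p with
  | zero => simp
  | succ p ih =>
    rw [Finset.sum_range_succ, ih, Finset.sum_range_succ _ p]
    push_cast
    ring

theorem sub_sum_mul_le {c w : ℕ → ℝ} {p i : ℕ} (hc : ∀ m < p, c m ≤ c (m + 1)) (hi : i ≤ p)
    (hw : ∀ m, 0 ≤ w m) (hw1 : ∀ m, i ≤ m → m < p → w m = 1) :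
    c p - ∑ m ∈ Finset.range p, w m * (c (m + 1) - c m) ≤ c i := by
  induction p, hi using Nat.le_induction with
  | base =>
    have : 0 ≤ ∑ m ∈ Finset.range i, w m * (c (m + 1) - c m) :=
      Finset.sum_nonneg fun m hm =>
        mul_nonneg (hw m) (sub_nonneg.2 (hc m (Finset.mem_range.1 hm)))
    linarith
  | succ p hp ih =>
    have := ih (fun m hm => hc m (by omega)) fun m h1 h2 => hw1 m h1 (by omega)
    rw [Finset.sum_range_succ, hw1 p hp (by omega)]
    linarith

end Summation

section Cutoff

variable {n : ℕ}

/-- A continuous function of `x`, equal to `1` where the inner products of `x` with `e l`, `l > m`,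
are small, and vanishing where they are not, at scale `1 / (N + 1)`. -/
noncomputable def tailCutoff (e : Fin n → EuclideanSpace ℝ (Fin n)) (N m : ℕ)
    (x : EuclideanSpace ℝ (Fin n)) : ℝ :=
  max 0 (min 1 (2 - (N + 1) * ∑ l with m < l.1, |⟪x, e l⟫|))

variable (e : Fin n → EuclideanSpace ℝ (Fin n))

theorem continuous_tailCutoff (N m : ℕ) : Continuous (tailCutoff e N m) := by
  unfold tailCutoff
  fun_prop

theorem tailCutoff_nonneg (N m : ℕ) (x : EuclideanSpace ℝ (Fin n)) : 0 ≤ tailCutoff e N m x :=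
  le_max_left _ _

theorem tailCutoff_le_one (N m : ℕ) (x : EuclideanSpace ℝ (Fin n)) : tailCutoff e N m x ≤ 1 :=
  max_le zero_le_one (min_le_left _ _)

theorem tailCutoff_eq_one {N m : ℕ} {x : EuclideanSpace ℝ (Fin n)}
    (hx : ∀ l : Fin n, m < l.1 → |⟪x, e l⟫| ≤ 1 / (n * (N + 1))) : tailCutoff e N m x = 1 := by
  have hsum : (N + 1) * ∑ l : Fin n with m < l.1, |⟪x, e l⟫| ≤ 1 := by
    rcases Nat.eq_zero_or_pos n with rfl | hn
    · simp
    have hn' : (0 : ℝ) < n := by exact_mod_cast hn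
    calc (N + 1) * ∑ l : Fin n with m < l.1, |⟪x, e l⟫|
        ≤ (N + 1) * ∑ l : Fin n with m < l.1, 1 / ((n : ℝ) * (N + 1)) := by
          gcongr with l hl
          exact hx l (Finset.mem_filter.1 hl).2
      _ ≤ (N + 1) * ∑ l : Fin n, 1 / ((n : ℝ) * (N + 1)) := by
          gcongr
          exact Finset.subset_univ _
      _ = 1 := by
          rw [Finset.sum_const, Finset.card_univ, Fintype.card_fin, nsmul_eq_mul]
          field_simp
  rw [tailCutoff, min_eq_left (by linarith), max_eq_right zero_le_one]

theorem tendsto_tailCutoff (m : ℕ) (x : EuclideanSpace ℝ (Fin n)) :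
    Tendsto (fun N => tailCutoff e N m x) atTop
      (nhds ({x | ∀ l : Fin n, m < l.1 → ⟪x, e l⟫ = 0}.indicator 1 x)) := by
  by_cases hx : ∀ l : Fin n, m < l.1 → ⟪x, e l⟫ = 0
  · rw [Set.indicator_of_mem (by exact hx)]
    refine tendsto_const_nhds.congr fun N => (tailCutoff_eq_one e fun l hl => ?_).symm
    rw [hx l hl, abs_zero]
    positivity
  · rw [Set.indicator_of_notMem (by exact hx)]
    push Not at hx
    obtain ⟨l, hl, hxl⟩ := hx
    have hpos : 0 < ∑ l : Fin n with m < l.1, |⟪x, e l⟫| :=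
      Finset.sum_pos' (fun _ _ => abs_nonneg _) ⟨l, by simpa using hl, abs_pos.2 hxl⟩
    refine tendsto_const_nhds.congr' ?_
    filter_upwards [(tendsto_natCast_atTop_atTop (R := ℝ)).eventually_ge_atTop
      (2 / ∑ l : Fin n with m < l.1, |⟪x, e l⟫|)] with N hN
    rw [div_le_iff₀ hpos] at hN
    refine (max_eq_left (min_le_of_right_le ?_)).symm
    linarith

theorem tendsto_integral_tailCutoff (m : ℕ)
    (μ : Measure ↥(Metric.sphere (0 : EuclideanSpace ℝ (Fin n)) 1)) [IsFiniteMeasure μ] :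
    Tendsto (fun N => ∫ x, tailCutoff e N m x ∂μ) atTop
      (nhds (μ {x | ∀ l : Fin n, m < l.1 → ⟪(x : EuclideanSpace ℝ (Fin n)), e l⟫ = 0}).toReal) := by
  set A : Set ↥(Metric.sphere (0 : EuclideanSpace ℝ (Fin n)) 1) :=
    {x | ∀ l : Fin n, m < l.1 → ⟪(x : EuclideanSpace ℝ (Fin n)), e l⟫ = 0} with hA
  have hmeas : MeasurableSet A := by
    refine IsClosed.measurableSet ?_
    simp only [hA, Set.ofPred_forall]
    exact isClosed_iInter fun l => isClosed_iInter fun _ =>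
      isClosed_eq (by fun_prop) continuous_const
  have hint : (μ A).toReal = ∫ x, A.indicator 1 x ∂μ := (integral_indicator_one hmeas).symm
  rw [hint]
  refine tendsto_integral_of_dominated_convergence (fun _ => 1)
    (fun N => ((continuous_tailCutoff e N m).comp
      continuous_subtype_val).aestronglyMeasurable) (integrable_const _) (fun N => ?_) ?_
  · refine Eventually.of_forall fun x => ?_
    rw [Real.norm_of_nonneg (tailCutoff_nonneg e N m x)]
    exact tailCutoff_le_one e N m x
  · exact Eventually.of_forall fun x => tendsto_tailCutoff e m x

end Cutoff

section SubspaceMass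

variable {n : ℕ} (b : OrthonormalBasis (Fin n) ℝ (EuclideanSpace ℝ (Fin n)))

theorem exists_finrank_eq_of_inner_eq_zero {m : ℕ} (hm : m < n) :
    ∃ ξ : Submodule ℝ (EuclideanSpace ℝ (Fin n)), Module.finrank ℝ ξ = m + 1 ∧
      ∀ x, (∀ l : Fin n, m < l.1 → ⟪x, b l⟫ = 0) → x ∈ ξ := by
  refine ⟨Submodule.span ℝ (Set.range fun i : Fin (m + 1) => b (Fin.castLE hm i)), ?_, ?_⟩
  · have hli : LinearIndependent ℝ fun i : Fin (m + 1) => b (Fin.castLE hm i) :=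
      b.orthonormal.linearIndependent.comp _ (Fin.castLE_injective hm)
    rw [finrank_span_eq_card hli, Fintype.card_fin]
  · intro x hx
    rw [← b.sum_repr' x]
    refine Submodule.sum_mem _ fun l _ => ?_
    by_cases hl : m < l.1
    · rw [real_inner_comm, hx l hl, zero_smul]
      exact Submodule.zero_mem _
    · exact Submodule.smul_mem _ _ (Submodule.subset_span ⟨⟨l.1, by omega⟩, rfl⟩)

theorem exists_one_div_le_abs_inner (hn : 0 < n) {x : EuclideanSpace ℝ (Fin n)} (hx : ‖x‖ = 1)
    (N : ℕ) :
    ∃ i : Fin n, 1 / (n * (N + 1)) ≤ |⟪x, b i⟫| ∧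
      ∀ l : Fin n, i < l → |⟪x, b l⟫| ≤ 1 / (n * (N + 1)) := by
  have hn' : (1 : ℝ) ≤ n := by exact_mod_cast hn
  set s : Finset (Fin n) := {i | 1 / ((n : ℝ) * (N + 1)) ≤ |⟪x, b i⟫|} with hs
  have hne : s.Nonempty := by
    by_contra! h
    have hlt : ∀ i, |⟪x, b i⟫| < 1 / (n : ℝ) := fun i => by
      have : i ∉ s := by simp [h]
      rw [hs, Finset.mem_filter] at this
      push Not at this
      refine (this (Finset.mem_univ i)).trans_le ?_
      gcongr
      nlinarith [(Nat.cast_nonneg N : (0 : ℝ) ≤ N)]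
    have hsum : ∑ i, ⟪x, b i⟫ ^ 2 < ∑ _i : Fin n, 1 / (n : ℝ) := by
      refine Finset.sum_lt_sum_of_nonempty ⟨⟨0, hn⟩, Finset.mem_univ _⟩ fun i _ => ?_
      have h1 : 1 / (n : ℝ) ≤ 1 := by rw [div_le_one (by linarith)]; exact hn'
      have h2 := hlt i
      rw [← sq_abs]
      nlinarith [abs_nonneg ⟪x, b i⟫]
    rw [b.sum_sq_inner_left, hx, Finset.sum_const, Finset.card_univ, Fintype.card_fin,
      nsmul_eq_mul, mul_one_div_cancel (by positivity)] at hsum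
    norm_num at hsum
  refine ⟨s.max' hne, (Finset.mem_filter.1 (s.max'_mem hne)).2, fun l hl => ?_⟩
  by_contra! h
  exact (s.le_max' l (by simpa [hs] using h.le)).not_gt hl

end SubspaceMass

/-- A pointwise lower bound for the logarithm of the support function of an ellipsoid whose axes
`b` are close to the orthonormal basis `b₀`. -/
theorem log_supportFn_ellipsoid_ge {p : ℕ}
    (b₀ b : OrthonormalBasis (Fin (p + 1)) ℝ (EuclideanSpace ℝ (Fin (p + 1))))
    {a : Fin (p + 1) → ℝ} (ha : ∀ k, 0 < a k) {c : ℕ → ℝ} (hc : ∀ m < p, c m ≤ c (m + 1))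
    (hca : ∀ k : Fin (p + 1), c k = Real.log (a k)) {N : ℕ}
    (hb : ∀ k, ‖b k - b₀ k‖ ≤ 1 / ((p + 1 : ℕ) * (N + 1)) / 2)
    {x : EuclideanSpace ℝ (Fin (p + 1))} (hx : ‖x‖ = 1) :
    Real.log (1 / ((p + 1 : ℕ) * (N + 1)) / 2) +
      (c p - ∑ m ∈ Finset.range p, tailCutoff b₀ N m x * (c (m + 1) - c m)) ≤
      Real.log (supportFn {y | ∑ k, ⟪y, b k⟫ ^ 2 / a k ^ 2 ≤ 1} x) := by
  set δ : ℝ := 1 / ((p + 1 : ℕ) * (N + 1)) with hδ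
  have hδ0 : 0 < δ := by positivity
  obtain ⟨i, hi, hil⟩ := exists_one_div_le_abs_inner b₀ p.succ_pos hx N
  have hx0 : x ≠ 0 := by rintro rfl; simp at hx
  have hinner : δ / 2 ≤ |⟪x, b i⟫| := by
    have h1 : |⟪x, b i - b₀ i⟫| ≤ δ / 2 := by
      refine (abs_real_inner_le_norm _ _).trans ?_
      rw [hx, one_mul]
      exact hb i
    rw [inner_sub_right] at h1
    have h2 := abs_sub_abs_le_abs_sub ⟪x, b₀ i⟫ ⟪x, b i⟫
    rw [abs_sub_comm] at h2
    have hi' : δ ≤ |⟪x, b₀ i⟫| := hi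
    linarith
  have hsum := sub_sum_mul_le (w := fun m => tailCutoff b₀ N m x) hc (Nat.lt_succ_iff.1 i.2)
    (fun m => tailCutoff_nonneg b₀ N m x) fun m him _ =>
      tailCutoff_eq_one b₀ fun l hl => hil l (Fin.lt_def.2 (him.trans_lt hl))
  rw [hca i] at hsum
  calc _ ≤ Real.log (δ / 2) + Real.log (a i) := by gcongr
    _ = Real.log (a i * (δ / 2)) := by
      rw [Real.log_mul (ha i).ne' (by positivity), add_comm]
    _ ≤ _ := by
      refine Real.log_le_log (mul_pos (ha i) (by positivity)) ?_
      exact (mul_le_mul_of_nonneg_left hinner (ha i).le).trans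
        (mul_abs_inner_le_supportFn_ellipsoid b ha hx0 i)

theorem average_log_supportFn_ellipsoid_ge {p : ℕ}
    (b₀ b : OrthonormalBasis (Fin (p + 1)) ℝ (EuclideanSpace ℝ (Fin (p + 1))))
    {a : Fin (p + 1) → ℝ} (ha : ∀ k, 0 < a k) (hmono : Monotone a) {N : ℕ}
    (hb : ∀ k, ‖b k - b₀ k‖ ≤ 1 / ((p + 1 : ℕ) * (N + 1)) / 2) {t : ℝ}
    (ν : Measure ↥(Metric.sphere (0 : EuclideanSpace ℝ (Fin (p + 1))) 1)) [IsFiniteMeasure ν]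
    (hν : 0 < (ν Set.univ).toReal)
    (ht : ∀ m < p, ∫ x, tailCutoff b₀ N m x ∂ν ≤
      (1 - t) * (((m + 1 : ℕ) : ℝ) / (p + 1 : ℕ) * (ν Set.univ).toReal)) :
    Real.log (1 / ((p + 1 : ℕ) * (N + 1)) / 2) + t * Real.log (a (Fin.last p)) +
        (1 - t) / (p + 1 : ℕ) * ∑ k, Real.log (a k) ≤
      1 / (ν Set.univ).toReal *
        ∫ x, Real.log (supportFn {y | ∑ k, ⟪y, b k⟫ ^ 2 / a k ^ 2 ≤ 1} x) ∂ν := by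
  set M := (ν Set.univ).toReal with hM
  set δ : ℝ := 1 / ((p + 1 : ℕ) * (N + 1)) with hδ
  obtain ⟨c, hca⟩ : ∃ c : ℕ → ℝ, ∀ k : Fin (p + 1), c k = Real.log (a k) :=
    ⟨fun m => if h : m < p + 1 then Real.log (a ⟨m, h⟩) else 0, fun k => dif_pos k.2⟩
  have hc : ∀ m < p, c m ≤ c (m + 1) := fun m hm => by
    have h1 := hca ⟨m, by omega⟩
    have h2 := hca ⟨m + 1, by omega⟩
    simp only at h1 h2
    rw [h1, h2]
    exact Real.log_le_log (ha _) (hmono (by simp [Fin.le_def]))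
  have hcint : ∀ f : ↥(Metric.sphere (0 : EuclideanSpace ℝ (Fin (p + 1))) 1) → ℝ,
      Continuous f → Integrable f ν := fun f hf =>
    hf.integrable_of_hasCompactSupport (HasCompactSupport.of_compactSpace f)
  have hcut : ∀ m, Integrable (fun x : ↥(Metric.sphere (0 : EuclideanSpace ℝ (Fin (p + 1))) 1) =>
      tailCutoff b₀ N m x) ν := fun m =>
    hcint _ ((continuous_tailCutoff b₀ N m).comp continuous_subtype_val)
  have hsumint : Integrable (fun x : ↥(Metric.sphere (0 : EuclideanSpace ℝ (Fin (p + 1))) 1) =>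
      ∑ m ∈ Finset.range p, tailCutoff b₀ N m x * (c (m + 1) - c m)) ν :=
    integrable_finsetSum _ fun m _ => (hcut m).mul_const _
  have hsub : Integrable (fun x : ↥(Metric.sphere (0 : EuclideanSpace ℝ (Fin (p + 1))) 1) =>
      c p - ∑ m ∈ Finset.range p, tailCutoff b₀ N m x * (c (m + 1) - c m)) ν :=
    (integrable_const _).sub hsumint
  have hle := integral_mono ((integrable_const (Real.log (δ / 2))).add hsub)
    (hcint _ (continuous_log_supportFn_ellipsoid b ha))
    fun x => log_supportFn_ellipsoid_ge b₀ b ha hc hca hb (mem_sphere_zero_iff_norm.1 x.2)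
  have hI : ∫ x : ↥(Metric.sphere (0 : EuclideanSpace ℝ (Fin (p + 1))) 1), (Real.log (δ / 2) +
      (c p - ∑ m ∈ Finset.range p, tailCutoff b₀ N m x * (c (m + 1) - c m))) ∂ν =
      M * Real.log (δ / 2) + (M * c p -
        ∑ m ∈ Finset.range p, (∫ x, tailCutoff b₀ N m x ∂ν) * (c (m + 1) - c m)) := by
    rw [integral_add (integrable_const _) hsub,
      integral_sub (integrable_const _) hsumint,
      integral_finsetSum _ fun m _ => (hcut m).mul_const _]
    simp only [integral_mul_const, integral_const, smul_eq_mul, Measure.real, hM]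
  have hle' := hI.symm.trans_le hle
  have hbound : ∑ m ∈ Finset.range p, (∫ x, tailCutoff b₀ N m x ∂ν) * (c (m + 1) - c m) ≤
      ∑ m ∈ Finset.range p, (1 - t) * (((m + 1 : ℕ) : ℝ) / (p + 1 : ℕ) * M) *
        (c (m + 1) - c m) :=
    Finset.sum_le_sum fun m hm => mul_le_mul_of_nonneg_right (ht m (Finset.mem_range.1 hm))
      (sub_nonneg.2 (hc m (Finset.mem_range.1 hm)))
  have hfac : ∑ m ∈ Finset.range p, (1 - t) * (((m + 1 : ℕ) : ℝ) / (p + 1 : ℕ) * M) *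
      (c (m + 1) - c m) =
      M * ((1 - t) / (p + 1 : ℕ) * ∑ m ∈ Finset.range p, (m + 1) * (c (m + 1) - c m)) := by
    rw [Finset.mul_sum, Finset.mul_sum]
    refine Finset.sum_congr rfl fun m _ => ?_
    push_cast
    ring
  have hsum : ∑ k, Real.log (a k) =
      (p + 1) * c p - ∑ m ∈ Finset.range p, (m + 1) * (c (m + 1) - c m) := by
    rw [← sum_range_succ_eq_mul_sub_sum, ← Fin.sum_univ_eq_sum_range]
    exact Finset.sum_congr rfl fun k _ => (hca k).symm
  have hlast : Real.log (a (Fin.last p)) = c p := (hca (Fin.last p)).symm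
  rw [one_div_mul_eq_div, le_div_iff₀ hν, hsum, hlast]
  have hcoef : (Real.log (δ / 2) + t * c p + (1 - t) / (p + 1 : ℕ) *
      ((p + 1) * c p - ∑ m ∈ Finset.range p, (m + 1) * (c (m + 1) - c m))) * M =
      M * Real.log (δ / 2) + (M * c p - M * ((1 - t) / (p + 1 : ℕ) *
        ∑ m ∈ Finset.range p, (m + 1) * (c (m + 1) - c m))) := by
    push_cast
    field_simp
    ring
  linarith

theorem ellipsoid_log_integral_lower_bound
    {n : ℕ} (hn : 2 ≤ n) (ε₀ : ℝ) (hε₀ : 0 < ε₀)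
    (e : ℕ → Fin n → EuclideanSpace ℝ (Fin n)) (he : ∀ j, Orthonormal ℝ (e j))
    (e₀ : Fin n → EuclideanSpace ℝ (Fin n)) (he₀ : Orthonormal ℝ e₀)
    (hlim : ∀ k, Tendsto (fun j => e j k) atTop (nhds (e₀ k)))
    (a : ℕ → Fin n → ℝ)
    (hapos : ∀ j k, 0 < a j k)
    (hamono : ∀ j, Monotone (a j))
    (halast : ∀ j, ε₀ ≤ a j ⟨n - 1, by omega⟩)
    (E : ℕ → Set (EuclideanSpace ℝ (Fin n)))
    (hE : ∀ j, E j = {x | ∑ k, (⟪x, e j k⟫) ^ 2 / (a j k) ^ 2 ≤ 1})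
    (μ : Measure ↥(Metric.sphere (0 : EuclideanSpace ℝ (Fin n)) 1))
    [IsFiniteMeasure μ] (hμne : μ ≠ 0)
    (hsmi : ∀ k : ℕ, 1 ≤ k → k ≤ n - 1 →
      ∀ ξ : Submodule ℝ (EuclideanSpace ℝ (Fin n)), Module.finrank ℝ ξ = k →
        (μ {x | (x : EuclideanSpace ℝ (Fin n)) ∈ ξ}).toReal <
          ((k : ℝ) / n) * (μ Set.univ).toReal)
    (μbar : ℕ → Measure ↥(Metric.sphere (0 : EuclideanSpace ℝ (Fin n)) 1))
    (hmass : ∀ j, (μbar j) Set.univ = μ Set.univ)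
    (hweak : ∀ f : ↥(Metric.sphere (0 : EuclideanSpace ℝ (Fin n)) 1) → ℝ, Continuous f →
      Tendsto (fun j => ∫ x, f x ∂(μbar j)) atTop (nhds (∫ x, f x ∂μ))) :
    ∃ δ₀ ∈ Set.Ioo (0 : ℝ) 1, ∃ t₀ ∈ Set.Ioo (0 : ℝ) 1, ∃ N₀ : ℕ, ∀ j > N₀,
      (1 / ((μbar j) Set.univ).toReal) *
          (∫ x, Real.log (supportFn (E j) (x : EuclideanSpace ℝ (Fin n))) ∂(μbar j)) ≥
        Real.log (δ₀ / 2) + t₀ * Real.log (a j ⟨n - 1, by omega⟩) +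
          ((1 - t₀) / n) * Real.log ((volume (E j)).toReal) -
          ((1 - t₀) / n) *
            Real.log ((volume (Metric.closedBall (0 : EuclideanSpace ℝ (Fin n)) 1)).toReal) := by
  obtain ⟨p, rfl⟩ : ∃ p, n = p + 1 := ⟨n - 1, by omega⟩
  change ∃ δ₀ ∈ Set.Ioo (0 : ℝ) 1, ∃ t₀ ∈ Set.Ioo (0 : ℝ) 1, ∃ N₀ : ℕ, ∀ j > N₀, _ ≥
    Real.log (δ₀ / 2) + t₀ * Real.log (a j (Fin.last p)) + _ - _
  obtain ⟨b₀, rfl⟩ := exists_orthonormalBasis_coe_eq he₀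
  have hfin : ∀ j, IsFiniteMeasure (μbar j) := fun j =>
    ⟨by rw [hmass j]; exact measure_lt_top _ _⟩
  set M := (μ Set.univ).toReal with hM
  have hM0 : 0 < M := ENNReal.toReal_pos (by simpa using hμne) (measure_ne_top _ _)
  have hlt : ∀ m ∈ Finset.range p, (μ {x | ∀ l : Fin (p + 1), m < l.1 →
      ⟪(x : EuclideanSpace ℝ (Fin (p + 1))), b₀ l⟫ = 0}).toReal <
        ((m + 1 : ℕ) : ℝ) / (p + 1 : ℕ) * M := fun m hm => by
    have hm := Finset.mem_range.1 hm
    obtain ⟨ξ, hξ, hmem⟩ := exists_finrank_eq_of_inner_eq_zero b₀ (m := m) (by omega)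
    refine lt_of_le_of_lt ?_ (hsmi (m + 1) (by omega) (by omega) ξ hξ)
    exact ENNReal.toReal_mono (measure_ne_top _ _) (measure_mono fun x hx => hmem x hx)
  obtain ⟨N, hN⟩ := ((Finset.eventually_all _).2 fun m hm =>
    (tendsto_integral_tailCutoff b₀ m μ).eventually_lt_const (hlt m hm)).exists
  obtain ⟨t, ht, ht01⟩ : ∃ t : ℝ, (∀ m ∈ Finset.range p, ∫ x, tailCutoff b₀ N m x ∂μ <
      (1 - t) * (((m + 1 : ℕ) : ℝ) / (p + 1 : ℕ) * M)) ∧ t ∈ Set.Ioo (0 : ℝ) 1 := by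
    refine (((Finset.eventually_all _).2 fun m hm => ?_).and
      (Ioo_mem_nhdsGT zero_lt_one)).exists (f := nhdsWithin (0 : ℝ) (Set.Ioi 0))
    refine (Tendsto.mono_left ?_ nhdsWithin_le_nhds).eventually_const_lt (hN m hm)
    have hcont : Continuous fun t : ℝ => (1 - t) * (((m + 1 : ℕ) : ℝ) / (p + 1 : ℕ) * M) := by
      fun_prop
    simpa using hcont.tendsto 0
  have hδ0 : (0 : ℝ) < 1 / ((p + 1 : ℕ) * (N + 1)) := by positivity
  have hδ1 : (1 : ℝ) / ((p + 1 : ℕ) * (N + 1)) < 1 := by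
    have h2 : (2 : ℝ) ≤ (p + 1 : ℕ) := by exact_mod_cast hn
    rw [div_lt_one (by positivity)]
    nlinarith [(Nat.cast_nonneg N : (0 : ℝ) ≤ N)]
  have hev1 : ∀ᶠ j in atTop, ∀ m ∈ Finset.range p, ∫ x, tailCutoff b₀ N m x ∂(μbar j) <
      (1 - t) * (((m + 1 : ℕ) : ℝ) / (p + 1 : ℕ) * M) :=
    (Finset.eventually_all _).2 fun m hm =>
      (hweak _ ((continuous_tailCutoff b₀ N m).comp
        continuous_subtype_val)).eventually_lt_const (ht m hm)
  have hev2 : ∀ᶠ j in atTop, ∀ k, ‖e j k - b₀ k‖ < 1 / ((p + 1 : ℕ) * (N + 1)) / 2 :=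
    eventually_all.2 fun k =>
      (tendsto_iff_norm_sub_tendsto_zero.1 (hlim k)).eventually_lt_const (by positivity)
  obtain ⟨N₀, hN₀⟩ := eventually_atTop.1 (hev1.and hev2)
  refine ⟨_, ⟨hδ0, hδ1⟩, t, ht01, N₀, fun j hj => ?_⟩
  obtain ⟨h1, h2⟩ := hN₀ j hj.le
  obtain ⟨b, hb⟩ := exists_orthonormalBasis_coe_eq (he j)
  have := hfin j
  rw [hE j]
  simp only [← hb] at h2 ⊢
  have hmain := average_log_supportFn_ellipsoid_ge b₀ b (hapos j) (hamono j)
    (fun k => (h2 k).le) (t := t) (μbar j) (by rw [hmass j]; exact hM0) fun m hm => by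
      rw [hmass j]; exact (h1 m (Finset.mem_range.2 hm)).le
  rw [log_volume_ellipsoid b (hapos j)]
  refine ge_iff_le.2 (le_trans (le_of_eq ?_) hmain)
  ring
end

section
/- Let Ω ⊆ ℝⁿ (n ≥ 2) be a nonempty bounded open convex set, and let u : ℝⁿ → ℝ be continuous on the closure of Ω, vanish on the boundary ∂Ω, be twice continuously differentiable on Ω, and satisfy Δu = −2 at every point of Ω. Then |∇u(x)| ≤ diam(Ω) for every x ∈ Ω. -/
/-- The Laplacian of `u : ℝⁿ → ℝ` at `x`: the sum of the second directional derivatives of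
`u` at `x` along the standard orthonormal basis of `ℝⁿ`. -/
noncomputable def lap {n : ℕ} (u : EuclideanSpace ℝ (Fin n) → ℝ)
    (x : EuclideanSpace ℝ (Fin n)) : ℝ :=
  ∑ i, fderiv ℝ (fun y => fderiv ℝ u y (EuclideanSpace.single i 1)) x
    (EuclideanSpace.single i 1)

open Filter Topology

/-- The directional derivative of a `C²` function is differentiable. -/
lemma ContDiffAt.differentiableAt_fderiv_apply {E : Type*} [NormedAddCommGroup E]
    [NormedSpace ℝ E] {f : E → ℝ} {x : E} (hf : ContDiffAt ℝ 2 f x) (e : E) :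
    DifferentiableAt ℝ (fun y => fderiv ℝ f y e) x :=
  ((hf.fderiv_right (m := 1) (by norm_num)).differentiableAt one_ne_zero).clm_apply
    (differentiableAt_const e)

lemma ContDiffAt.eventually_differentiableAt {E : Type*} [NormedAddCommGroup E]
    [NormedSpace ℝ E] {f : E → ℝ} {x : E} (hf : ContDiffAt ℝ 2 f x) :
    ∀ᶠ y in 𝓝 x, DifferentiableAt ℝ f y := by
  filter_upwards [hf.eventually (by simp)] with y hy
  exact hy.differentiableAt two_ne_zero

lemma lap_add {n : ℕ} {f g : EuclideanSpace ℝ (Fin n) → ℝ} {x : EuclideanSpace ℝ (Fin n)}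
    (hf : ContDiffAt ℝ 2 f x) (hg : ContDiffAt ℝ 2 g x) :
    lap (f + g) x = lap f x + lap g x := by
  simp only [lap, ← Finset.sum_add_distrib]
  refine Finset.sum_congr rfl fun i _ => ?_
  have h : (fun y => fderiv ℝ (f + g) y (EuclideanSpace.single i 1)) =ᶠ[𝓝 x]
      fun y => fderiv ℝ f y (EuclideanSpace.single i 1)
        + fderiv ℝ g y (EuclideanSpace.single i 1) := by
    filter_upwards [hf.eventually_differentiableAt, hg.eventually_differentiableAt] with y h1 h2
    rw [fderiv_add h1 h2]
    rfl
  rw [h.fderiv_eq, fderiv_fun_add (hf.differentiableAt_fderiv_apply _)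
    (hg.differentiableAt_fderiv_apply _)]
  rfl

lemma lap_neg {n : ℕ} (f : EuclideanSpace ℝ (Fin n) → ℝ) (x : EuclideanSpace ℝ (Fin n)) :
    lap (fun y => -f y) x = -lap f x := by
  simp [lap, fderiv_fun_neg]

lemma lap_comp_add_right {n : ℕ} (f : EuclideanSpace ℝ (Fin n) → ℝ)
    (x h : EuclideanSpace ℝ (Fin n)) :
    lap (fun y => f (y + h)) x = lap f (x + h) := by
  simp only [lap, fderiv_comp_add_right]
  refine Finset.sum_congr rfl fun i _ => ?_
  rw [fderiv_comp_add_right (f := fun y => fderiv ℝ f y (EuclideanSpace.single i 1))]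

lemma lap_sq_inner {n : ℕ} (a b c : ℝ) (v x : EuclideanSpace ℝ (Fin n)) :
    lap (fun y => a * (inner ℝ v y - c) ^ 2 + b) x = 2 * a * ‖v‖ ^ 2 := by
  have hd (y) : HasFDerivAt (fun y => inner ℝ v y - c) (innerSL ℝ v) y :=
    (innerSL ℝ v).hasFDerivAt.sub_const c
  have h1 (y e : EuclideanSpace ℝ (Fin n)) :
      fderiv ℝ (fun y => a * (inner ℝ v y - c) ^ 2 + b) y e
        = 2 * a * inner ℝ v e * (inner ℝ v y - c) := by
    rw [((((hd y).pow 2).const_mul a).add_const b).fderiv]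
    simp
    ring
  simp only [lap, h1]
  have h2 (k : ℝ) : fderiv ℝ (fun y => k * (inner ℝ v y - c)) x = k • innerSL ℝ v :=
    ((hd x).const_mul k).fderiv
  simp only [h2, EuclideanSpace.norm_sq_eq, Finset.mul_sum]
  refine Finset.sum_congr rfl fun i _ => ?_
  simp [EuclideanSpace.inner_single_right]
  ring

lemma contDiff_sq_inner {n : ℕ} (a b c : ℝ) (v : EuclideanSpace ℝ (Fin n)) :
    ContDiff ℝ 2 (fun y => a * (inner ℝ v y - c) ^ 2 + b) :=
  (contDiff_const.mul (((innerSL ℝ v).contDiff.sub contDiff_const).pow 2)).add contDiff_const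

lemma IsLocalMax.deriv_deriv_nonpos {g : ℝ → ℝ} {a : ℝ} (h : IsLocalMax g a)
    (hc : ContinuousAt g a) : deriv (deriv g) a ≤ 0 := by
  by_contra! hpos
  have hmin := isLocalMin_of_deriv_deriv_pos hpos h.deriv_eq_zero hc
  have hconst : g =ᶠ[𝓝 a] fun _ => g a := by
    filter_upwards [h, hmin] with t h1 h2 using le_antisymm h1 h2
  have := hconst.deriv.deriv_eq
  simp at this
  exact hpos.ne' this

lemma IsLocalMax.lap_nonpos {n : ℕ} {f : EuclideanSpace ℝ (Fin n) → ℝ}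
    {x : EuclideanSpace ℝ (Fin n)} (h : IsLocalMax f x) (hf : ContDiffAt ℝ 2 f x) :
    lap f x ≤ 0 := by
  refine Finset.sum_nonpos fun i _ => ?_
  set e : EuclideanSpace ℝ (Fin n) := EuclideanSpace.single i 1
  have hline (t : ℝ) : HasDerivAt (fun t : ℝ => x + t • e) e t := by
    simpa using ((hasDerivAt_id t).smul_const e).const_add x
  have hx : x + (0 : ℝ) • e = x := by simp
  have hlim : Tendsto (fun t : ℝ => x + t • e) (𝓝 0) (𝓝 x) := by
    simpa [ContinuousAt] using (hline 0).continuousAt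
  have hderiv : deriv (fun t : ℝ => f (x + t • e)) =ᶠ[𝓝 0] fun t => fderiv ℝ f (x + t • e) e := by
    filter_upwards [hlim.eventually hf.eventually_differentiableAt] with t ht
    exact (ht.hasFDerivAt.comp_hasDerivAt t (hline t)).deriv
  have hmax : IsLocalMax (fun t : ℝ => f (x + t • e)) 0 := by
    filter_upwards [hlim.eventually h] with t ht
    simpa using ht
  have hcont : ContinuousAt (fun t : ℝ => f (x + t • e)) 0 := by
    have := hf.continuousAt.tendsto.comp hlim
    simpa [ContinuousAt, Function.comp_def] using this
  have hsecond : HasDerivAt (fun t : ℝ => fderiv ℝ f (x + t • e) e)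
      (fderiv ℝ (fun y => fderiv ℝ f y e) x e) 0 := by
    have hd := (hf.differentiableAt_fderiv_apply e).hasFDerivAt
    rw [← hx] at hd
    have := hd.comp_hasDerivAt (0 : ℝ) (hline 0)
    rwa [hx] at this
  rw [← hsecond.deriv, ← hderiv.deriv_eq]
  exact hmax.deriv_deriv_nonpos hcont

lemma le_of_lap_pos {n : ℕ} {U : Set (EuclideanSpace ℝ (Fin n))} (hU : IsOpen U)
    (hb : Bornology.IsBounded U) {f : EuclideanSpace ℝ (Fin n) → ℝ}
    (hc : ContinuousOn f (closure U)) (hf : ContDiffOn ℝ 2 f U)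
    (hlap : ∀ x ∈ U, 0 < lap f x) {M : ℝ} (hM : ∀ x ∈ frontier U, f x ≤ M) :
    ∀ x ∈ closure U, f x ≤ M := by
  intro x hx
  obtain ⟨z, hz, hmax⟩ := hb.isCompact_closure.exists_isMaxOn ⟨x, hx⟩ hc
  refine (hmax hx).trans (hM z ?_)
  rw [hU.frontier_eq]
  refine ⟨hz, fun hzU => ?_⟩
  have hnhds := hU.mem_nhds hzU
  have hloc : IsLocalMax f z := by
    filter_upwards [hnhds] with y hy using hmax (subset_closure hy)
  exact (hlap z hzU).not_ge (hloc.lap_nonpos (hf.contDiffAt hnhds))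

/-- The weak maximum principle for subharmonic functions. -/
lemma le_of_lap_nonneg {n : ℕ} (hn : 0 < n) {U : Set (EuclideanSpace ℝ (Fin n))}
    (hU : IsOpen U) (hb : Bornology.IsBounded U) {f : EuclideanSpace ℝ (Fin n) → ℝ}
    (hc : ContinuousOn f (closure U)) (hf : ContDiffOn ℝ 2 f U)
    (hlap : ∀ x ∈ U, 0 ≤ lap f x) {M : ℝ} (hM : ∀ x ∈ frontier U, f x ≤ M) :
    ∀ x ∈ closure U, f x ≤ M := by
  intro x hx
  set v : EuclideanSpace ℝ (Fin n) := EuclideanSpace.single ⟨0, hn⟩ 1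
  have hv : ‖v‖ = 1 := by simp [v]
  obtain ⟨R, hR⟩ := hb.closure.exists_norm_le
  have key (ε : ℝ) (hε : 0 < ε) : f x ≤ M + ε * R ^ 2 := by
    have hq := contDiff_sq_inner ε 0 0 v
    have h := le_of_lap_pos hU hb (hc.add hq.continuous.continuousOn) (hf.add hq.contDiffOn)
      (fun y hy => ?_) (M := M + ε * R ^ 2) (fun y hy => ?_) x hx
    · have : 0 ≤ ε * (inner ℝ v x - 0) ^ 2 := by positivity
      rw [Pi.add_apply] at h
      linarith
    · rw [lap_add (hf.contDiffAt (hU.mem_nhds hy)) hq.contDiffAt, lap_sq_inner, hv]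
      linarith [hlap y hy]
    · have h1 : |inner ℝ v y| ≤ R := by
        refine (abs_real_inner_le_norm v y).trans ?_
        rw [hv, one_mul]
        exact hR y (frontier_subset_closure hy)
      have h2 : (inner ℝ v y) ^ 2 ≤ R ^ 2 := sq_le_sq' (abs_le.1 h1).1 (abs_le.1 h1).2
      have := mul_le_mul_of_nonneg_left h2 hε.le
      simp only [Pi.add_apply, sub_zero, add_zero]
      linarith [hM y hy]
  have hlim : Tendsto (fun ε : ℝ => M + ε * R ^ 2) (𝓝[>] 0) (𝓝 M) := by
    have : Continuous fun ε : ℝ => M + ε * R ^ 2 := by fun_prop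
    simpa using (this.tendsto 0).mono_left nhdsWithin_le_nhds
  exact ge_of_tendsto hlim (eventually_mem_nhdsWithin.mono fun ε hε => key ε hε)

/-- An open convex set has a unit inner normal at each point outside it. -/
lemma Convex.exists_unit_normal {E : Type*} [NormedAddCommGroup E] [InnerProductSpace ℝ E]
    [CompleteSpace E] {s : Set E} (hs : Convex ℝ s) (ho : IsOpen s) (hne : s.Nonempty) {z : E}
    (hz : z ∉ s) : ∃ v : E, ‖v‖ = 1 ∧ ∀ y ∈ closure s, 0 ≤ inner ℝ v (y - z) := by
  obtain ⟨φ, hφ⟩ := geometric_hahn_banach_point_open hs ho hz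
  set w := (InnerProductSpace.toDual ℝ E).symm φ
  have hw (y : E) : inner ℝ w y = φ y := InnerProductSpace.toDual_symm_apply
  have hw0 : w ≠ 0 := by
    obtain ⟨y, hy⟩ := hne
    intro h0
    have := hφ y hy
    simp [← hw, h0] at this
  refine ⟨‖w‖⁻¹ • w, norm_smul_inv_norm hw0, fun y hy => ?_⟩
  have hcl : IsClosed {y : E | 0 ≤ inner ℝ (‖w‖⁻¹ • w) (y - z)} :=
    isClosed_le (by fun_prop) (by fun_prop)
  refine closure_minimal (fun y hy => ?_) hcl hy
  have := hφ y hy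
  change 0 ≤ inner ℝ (‖w‖⁻¹ • w) (y - z)
  rw [real_inner_smul_left, inner_sub_right, hw, hw]
  exact mul_nonneg (by positivity) (by linarith)

section Torsion

variable {n : ℕ} {Ω : Set (EuclideanSpace ℝ (Fin n))} {u : EuclideanSpace ℝ (Fin n) → ℝ}

/-- A barrier given by the torsion function of a slab bounds `u` near the boundary. -/
lemma torsion_le_diam_mul_norm_sub (hn : 0 < n) (hne : Ω.Nonempty)
    (hbdd : Bornology.IsBounded Ω) (hopen : IsOpen Ω) (hconv : Convex ℝ Ω)
    (hcont : ContinuousOn u (closure Ω)) (hbd : ∀ x ∈ frontier Ω, u x = 0)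
    (hsmooth : ContDiffOn ℝ 2 u Ω) (hlap : ∀ x ∈ Ω, lap u x = -2)
    {z : EuclideanSpace ℝ (Fin n)} (hz : z ∈ frontier Ω) :
    ∀ y ∈ closure Ω, u y ≤ Metric.diam Ω * ‖y - z‖ := by
  intro y hy
  have hzc := frontier_subset_closure hz
  rw [hopen.frontier_eq] at hz
  obtain ⟨v, hv, hpos⟩ := hconv.exists_unit_normal hopen hne hz.2
  set D := Metric.diam Ω with hD
  have hinner (y) : inner ℝ v (y - z) ≤ ‖y - z‖ := by
    simpa [hv] using real_inner_le_norm v (y - z)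
  have hle (y) (hy : y ∈ closure Ω) : inner ℝ v (y - z) ≤ D := by
    refine (hinner y).trans ?_
    rw [← dist_eq_norm, hD, ← Metric.diam_closure]
    exact Metric.dist_le_diam_of_mem hbdd.closure hy hzc
  have hq := contDiff_sq_inner 1 (-(D ^ 2 / 4)) (inner ℝ v z + D / 2) v
  have heq (y) : 1 * (inner ℝ v y - (inner ℝ v z + D / 2)) ^ 2 + -(D ^ 2 / 4)
      = -(inner ℝ v (y - z) * (D - inner ℝ v (y - z))) := by
    rw [inner_sub_right]
    ring
  have h := le_of_lap_nonneg hn hopen hbdd (hcont.add hq.continuous.continuousOn)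
    (hsmooth.add hq.contDiffOn) (fun w hw => ?_) (M := 0) (fun w hw => ?_) y hy
  · rw [Pi.add_apply, heq] at h
    have h0 := hpos y hy
    have hD0 : 0 ≤ D := Metric.diam_nonneg
    nlinarith [mul_le_mul_of_nonneg_left (hinner y) hD0]
  · rw [lap_add (hsmooth.contDiffAt (hopen.mem_nhds hw)) hq.contDiffAt, lap_sq_inner, hv,
      hlap w hw]
    norm_num
  · have hwc := frontier_subset_closure hw
    rw [Pi.add_apply, heq, hbd w hw]
    have := mul_nonneg (hpos w hwc) (sub_nonneg.2 (hle w hwc))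
    linarith

/-- Comparing the torsion function with its translates shows that it is Lipschitz. -/
lemma torsion_sub_le_diam_mul_norm_sub (hn : 0 < n) (hne : Ω.Nonempty)
    (hbdd : Bornology.IsBounded Ω) (hopen : IsOpen Ω) (hconv : Convex ℝ Ω)
    (hcont : ContinuousOn u (closure Ω)) (hbd : ∀ x ∈ frontier Ω, u x = 0)
    (hsmooth : ContDiffOn ℝ 2 u Ω) (hlap : ∀ x ∈ Ω, lap u x = -2)
    {x y : EuclideanSpace ℝ (Fin n)} (hx : x ∈ Ω) (hy : y ∈ Ω) :
    u y - u x ≤ Metric.diam Ω * ‖y - x‖ := by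
  have hnonneg (z) (hz : z ∈ closure Ω) : 0 ≤ u z := by
    have h := le_of_lap_nonneg hn hopen hbdd hcont.neg hsmooth.neg (fun w hw => ?_) (M := 0)
      (fun w hw => ?_) z hz
    · simpa using h
    · have := lap_neg u w
      rw [hlap w hw] at this
      exact le_of_le_of_eq (by norm_num) this.symm
    · simp [hbd w hw]
  set h := y - x with hh
  set U := Ω ∩ (fun z => z + h) ⁻¹' Ω
  have hadd : Continuous fun z : EuclideanSpace ℝ (Fin n) => z + h := by fun_prop
  have hU : IsOpen U := hopen.inter (hopen.preimage hadd)
  have hcl1 : closure U ⊆ closure Ω := closure_mono Set.inter_subset_left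
  have hcl2 : Set.MapsTo (fun z => z + h) (closure U) (closure Ω) :=
    Set.MapsTo.closure (fun z hz => hz.2) hadd
  have hshift : ContDiffOn ℝ 2 (fun z => u (z + h)) U :=
    hsmooth.comp (by fun_prop) fun z hz => hz.2
  have hneg : ContDiffOn ℝ 2 (fun z => -u z) U := (hsmooth.mono Set.inter_subset_left).neg
  have hxU : x ∈ U := ⟨hx, by simpa [hh] using hy⟩
  have key := le_of_lap_nonneg hn hU (hbdd.subset Set.inter_subset_left)
    ((hcont.comp hadd.continuousOn hcl2).add (hcont.mono hcl1).neg) (hshift.add hneg)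
    (fun z hz => ?_) (M := Metric.diam Ω * ‖h‖) (fun z hz => ?_) x (subset_closure hxU)
  · have hxy : x + h = y := by simp [hh]
    simpa [hxy, sub_eq_add_neg] using key
  · have hnhds := hU.mem_nhds hz
    refine le_of_eq (Eq.symm ?_)
    refine (lap_add (hshift.contDiffAt hnhds) (hneg.contDiffAt hnhds)).trans ?_
    rw [lap_neg, lap_comp_add_right, hlap z hz.1, hlap _ hz.2]
    norm_num
  · rw [hU.frontier_eq] at hz
    have hz1 := hcl1 hz.1
    have hz2 : z + h ∈ closure Ω := hcl2 hz.1
    change u (z + h) + -u z ≤ _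
    by_cases hzΩ : z ∈ Ω
    · have hzh : z + h ∈ frontier Ω := by
        rw [hopen.frontier_eq]
        exact ⟨hz2, fun h' => hz.2 ⟨hzΩ, h'⟩⟩
      have : 0 ≤ Metric.diam Ω * ‖h‖ := mul_nonneg Metric.diam_nonneg (norm_nonneg h)
      linarith [hbd _ hzh, hnonneg z hz1]
    · have hzf : z ∈ frontier Ω := by
        rw [hopen.frontier_eq]
        exact ⟨hz1, hzΩ⟩
      have := torsion_le_diam_mul_norm_sub hn hne hbdd hopen hconv hcont hbd hsmooth hlap hzf
        (z + h) hz2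
      rw [add_sub_cancel_left] at this
      linarith [hbd z hzf]

end Torsion


theorem gradient_bound_for_torsion_function
    {n : ℕ} (hn : 2 ≤ n)
    (Ω : Set (EuclideanSpace ℝ (Fin n)))
    (hne : Ω.Nonempty) (hbdd : Bornology.IsBounded Ω) (hopen : IsOpen Ω)
    (hconv : Convex ℝ Ω)
    (u : EuclideanSpace ℝ (Fin n) → ℝ)
    (hcont : ContinuousOn u (closure Ω))
    (hbd : ∀ x ∈ frontier Ω, u x = 0)
    (hsmooth : ContDiffOn ℝ 2 u Ω)
    (hlap : ∀ x ∈ Ω, lap u x = -2) :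
    ∀ x ∈ Ω, ‖gradient u x‖ ≤ Metric.diam Ω := by
  intro x hx
  have hn0 : 0 < n := by lia
  have hsub {y z} (hy : y ∈ Ω) (hz : z ∈ Ω) :=
    torsion_sub_le_diam_mul_norm_sub hn0 hne hbdd hopen hconv hcont hbd hsmooth hlap hy hz
  rw [gradient, LinearIsometryEquiv.norm_map]
  refine norm_fderiv_le_of_lip' ℝ Metric.diam_nonneg ?_
  filter_upwards [hopen.mem_nhds hx] with y hy
  rw [Real.norm_eq_abs, abs_le]
  constructor
  · have := hsub hy hx
    rw [norm_sub_rev] at this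
    linarith
  · exact hsub hx hy
end

section
/- Let Ω ⊆ ℝⁿ (n ≥ 2) be a nonempty bounded open convex set, and let u : ℝⁿ → ℝ be continuous on the closure of Ω, vanish on the boundary ∂Ω, be twice continuously differentiable on Ω, and satisfy Δu = −2 at every point of Ω. Then u ≥ 0 on Ω and the function x ↦ √(u(x)) is concave on Ω. -/
open Set Filter Topology

/-- `g` is twice differentiable at `0`, with first derivative `a` and second derivative `d`. -/
def HasTwoJetAtZero (g : ℝ → ℝ) (a d : ℝ) : Prop :=
  ∃ g' : ℝ → ℝ, (∀ᶠ s in 𝓝 0, HasDerivAt g (g' s) s) ∧ g' 0 = a ∧ HasDerivAt g' d 0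

namespace HasTwoJetAtZero

variable {f g : ℝ → ℝ} {a b c d : ℝ}

theorem hasDerivAt (h : HasTwoJetAtZero g a d) : HasDerivAt g a 0 := by
  obtain ⟨g', h1, rfl, -⟩ := h
  exact h1.self_of_nhds

protected theorem congr (hf : HasTwoJetAtZero f a d) (h : ∀ s, f s = g s) :
    HasTwoJetAtZero g a d :=
  funext h ▸ hf

theorem sub (hf : HasTwoJetAtZero f a b) (hg : HasTwoJetAtZero g c d) :
    HasTwoJetAtZero (fun s => f s - g s) (a - c) (b - d) := by
  obtain ⟨f', h1, rfl, h2⟩ := hf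
  obtain ⟨g', h3, rfl, h4⟩ := hg
  refine ⟨fun s => f' s - g' s, ?_, rfl, h2.sub h4⟩
  filter_upwards [h1, h3] with s hs ht using hs.sub ht

theorem const_mul (k : ℝ) (hg : HasTwoJetAtZero g a d) :
    HasTwoJetAtZero (fun s => k * g s) (k * a) (k * d) := by
  obtain ⟨g', h1, rfl, h2⟩ := hg
  refine ⟨fun s => k * g' s, ?_, rfl, h2.const_mul k⟩
  filter_upwards [h1] with s hs using hs.const_mul k

theorem comp_mul (k : ℝ) (hg : HasTwoJetAtZero g a d) :
    HasTwoJetAtZero (fun s => g (k * s)) (k * a) (k ^ 2 * d) := by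
  obtain ⟨g', h1, rfl, h2⟩ := hg
  have hlin : ∀ s : ℝ, HasDerivAt (fun s : ℝ => k * s) k s := fun s => by
    simpa using (hasDerivAt_id s).const_mul k
  have ht : Tendsto (fun s : ℝ => k * s) (𝓝 0) (𝓝 0) := by
    simpa using (hlin 0).continuousAt.tendsto
  refine ⟨fun s => k * g' (k * s), ?_, by simp, ?_⟩
  · filter_upwards [ht.eventually h1] with s hs
    exact (hs.comp s (hlin s)).congr_deriv (mul_comm _ _)
  · have h2' : HasDerivAt g' d (k * 0) := by simpa using h2
    exact ((h2'.comp 0 (hlin 0)).const_mul k).congr_deriv (by ring)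

theorem sqrt (hg : HasTwoJetAtZero g a d) (h0 : 0 < g 0) :
    HasTwoJetAtZero (fun s => √(g s)) (a / (2 * √(g 0)))
      (d / (2 * √(g 0)) - (a / (2 * √(g 0))) ^ 2 / √(g 0)) := by
  have hga := hg.hasDerivAt
  obtain ⟨g', h1, rfl, h2⟩ := hg
  refine ⟨fun s => g' s / (2 * √(g s)), ?_, rfl, ?_⟩
  · filter_upwards [h1, hga.continuousAt.eventually (lt_mem_nhds h0)] with s hs hpos
    exact hs.sqrt hpos.ne'
  · have hs := Real.sqrt_pos.2 h0
    refine (h2.div ((hga.sqrt h0.ne').const_mul 2) (by positivity)).congr_deriv ?_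
    field_simp

theorem quadratic (p q r : ℝ) :
    HasTwoJetAtZero (fun s => p * s ^ 2 + q * s + r) q (2 * p) := by
  refine ⟨fun s => 2 * p * s + q, .of_forall fun s => ?_, by simp, ?_⟩
  · refine ((((hasDerivAt_id s).pow 2).const_mul p).add ((hasDerivAt_id s).const_mul q)
      |>.add_const r).congr_deriv ?_
    simp
    ring
  · simpa using ((hasDerivAt_id (0 : ℝ)).const_mul (2 * p)).add_const q

theorem eq_zero_of_isLocalMin (hg : HasTwoJetAtZero g a d) (hm : IsLocalMin g 0) : a = 0 :=
  hm.hasDerivAt_eq_zero hg.hasDerivAt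

theorem nonneg_of_isLocalMin (hg : HasTwoJetAtZero g a d) (hm : IsLocalMin g 0) : 0 ≤ d := by
  have ha := hg.eq_zero_of_isLocalMin hm
  have hga := hg.hasDerivAt
  obtain ⟨g', h1, rfl, h2⟩ := hg
  by_contra! hd
  have hderiv : deriv g =ᶠ[𝓝 0] g' := h1.mono fun s hs => hs.deriv
  have hdd : deriv (deriv g) 0 = d := hderiv.deriv_eq.trans h2.deriv
  have hmax : IsLocalMax g 0 :=
    isLocalMax_of_deriv_deriv_neg (hdd ▸ hd) (hga.deriv.trans ha) hga.continuousAt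
  have hconst : g =ᶠ[𝓝 0] fun _ => g 0 := by
    filter_upwards [hm, hmax] with s h3 h4 using le_antisymm h4 h3
  have hzero : deriv (deriv g) 0 = 0 := by
    rw [hconst.deriv.deriv_eq]
    simp
  exact hd.ne (hdd.symm.trans hzero)

end HasTwoJetAtZero

theorem ContDiffOn.hasTwoJetAtZero {E : Type*} [NormedAddCommGroup E] [NormedSpace ℝ E]
    {Ω : Set E} {u : E → ℝ} (hu : ContDiffOn ℝ 2 u Ω) (hopen : IsOpen Ω) {x : E} (hx : x ∈ Ω)
    (e : E) :
    HasTwoJetAtZero (fun s : ℝ => u (x + s • e)) (fderiv ℝ u x e)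
      (fderiv ℝ (fun y => fderiv ℝ u y e) x e) := by
  have hline : ∀ s : ℝ, HasDerivAt (fun s : ℝ => x + s • e) e s := fun s => by
    simpa using ((hasDerivAt_id s).smul_const e).const_add x
  have ht : Tendsto (fun s : ℝ => x + s • e) (𝓝 0) (𝓝 x) := by
    simpa using (hline 0).continuousAt.tendsto
  refine ⟨fun s => fderiv ℝ u (x + s • e) e, ?_, by simp, ?_⟩
  · filter_upwards [ht.eventually (hopen.mem_nhds hx)] with s hs
    have hd : DifferentiableAt ℝ u (x + s • e) :=
      (hu.differentiableOn (by norm_num)).differentiableAt (hopen.mem_nhds hs)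
    exact hd.hasFDerivAt.comp_hasDerivAt s (hline s)
  · have hd : DifferentiableAt ℝ (fderiv ℝ u) x :=
      ((hu.fderiv_of_isOpen (m := 1) hopen (by norm_num)).differentiableOn
        (by norm_num)).differentiableAt (hopen.mem_nhds hx)
    have hd' : DifferentiableAt ℝ (fun y => fderiv ℝ u y e) (x + (0 : ℝ) • e) := by
      simpa using hd.clm_apply (differentiableAt_const e)
    have h := hd'.hasFDerivAt.comp_hasDerivAt (0 : ℝ) (hline 0)
    simp only [zero_smul, add_zero] at h
    exact h

theorem EuclideanSpace.norm_sq_add_smul_single {n : ℕ} (x : EuclideanSpace ℝ (Fin n)) (i : Fin n)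
    (s : ℝ) :
    ‖x + s • EuclideanSpace.single i (1 : ℝ)‖ ^ 2 = s ^ 2 + 2 * x i * s + ‖x‖ ^ 2 := by
  rw [norm_add_sq_real, inner_smul_right, norm_smul, EuclideanSpace.inner_single_right]
  simp
  ring

/-- The weak minimum principle for superharmonic functions on a bounded open set. -/
theorem nonneg_of_superharmonic {n : ℕ} (hn : 0 < n) {Ω : Set (EuclideanSpace ℝ (Fin n))}
    (hbdd : Bornology.IsBounded Ω) (hopen : IsOpen Ω) {w : EuclideanSpace ℝ (Fin n) → ℝ}
    (hcont : ContinuousOn w (closure Ω)) (hbd : ∀ x ∈ frontier Ω, 0 ≤ w x)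
    (hw : ∀ x ∈ Ω, ∃ a d : Fin n → ℝ, ∑ i, d i ≤ 0 ∧
      ∀ i, HasTwoJetAtZero (fun s : ℝ => w (x + s • EuclideanSpace.single i 1)) (a i) (d i)) :
    ∀ x ∈ closure Ω, 0 ≤ w x := by
  intro x hx
  obtain ⟨R, hR⟩ := hbdd.closure.exists_norm_le
  have hR0 : 0 ≤ R := (norm_nonneg x).trans (hR x hx)
  have key : ∀ ε > 0, -(ε * R ^ 2) ≤ w x := by
    intro ε hε
    obtain ⟨y, hy, hmin⟩ := hbdd.isCompact_closure.exists_isMinOn ⟨x, hx⟩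
      (f := fun y => w y - ε * ‖y‖ ^ 2) (by fun_prop)
    have hyf : y ∈ frontier Ω := by
      rw [hopen.frontier_eq]
      refine ⟨hy, fun hyΩ => ?_⟩
      obtain ⟨a, d, hd, hj⟩ := hw y hyΩ
      have hpos : ∀ i, 0 ≤ d i - 2 * ε := by
        intro i
        have hq := (hj i).sub
          (HasTwoJetAtZero.quadratic ε (ε * (2 * y i)) (ε * ‖y‖ ^ 2))
        refine hq.nonneg_of_isLocalMin ?_
        have ht : Tendsto (fun s : ℝ => y + s • EuclideanSpace.single i (1 : ℝ)) (𝓝 0) (𝓝 y) := by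
          have : Continuous fun s : ℝ => y + s • EuclideanSpace.single i (1 : ℝ) := by fun_prop
          simpa using this.tendsto 0
        filter_upwards [ht.eventually (hopen.mem_nhds hyΩ)] with s hs
        have h := hmin (subset_closure hs)
        simp only [mem_ofPred_eq, EuclideanSpace.norm_sq_add_smul_single] at h
        simp only [zero_smul, add_zero]
        linarith
      have hsum : 0 ≤ ∑ i, (d i - 2 * ε) := Finset.sum_nonneg fun i _ => hpos i
      simp only [Finset.sum_sub_distrib, Finset.sum_const, Finset.card_univ, Fintype.card_fin,
        nsmul_eq_mul] at hsum
      have : (0 : ℝ) < n := by exact_mod_cast hn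
      nlinarith [mul_pos this hε]
    have h := hmin hx
    simp only [mem_ofPred_eq] at h
    have h1 : ‖y‖ ^ 2 ≤ R ^ 2 := pow_le_pow_left₀ (norm_nonneg y) (hR y hy) 2
    nlinarith [hbd y hyf, mul_le_mul_of_nonneg_left h1 hε.le, mul_nonneg hε.le (sq_nonneg ‖x‖)]
  have hlim : Tendsto (fun ε : ℝ => -(ε * R ^ 2)) (𝓝[>] 0) (𝓝 0) := by
    have : Continuous fun ε : ℝ => -(ε * R ^ 2) := by fun_prop
    simpa using (this.tendsto 0).mono_left nhdsWithin_le_nhds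
  exact le_of_tendsto hlim (eventually_nhdsWithin_of_forall key)

section Torsion

variable {n : ℕ} {Ω : Set (EuclideanSpace ℝ (Fin n))} {u : EuclideanSpace ℝ (Fin n) → ℝ}

theorem torsion_nonneg (hn : 0 < n) (hbdd : Bornology.IsBounded Ω) (hopen : IsOpen Ω)
    (hcont : ContinuousOn u (closure Ω)) (hbd : ∀ x ∈ frontier Ω, u x = 0)
    (hsmooth : ContDiffOn ℝ 2 u Ω) (hlap : ∀ x ∈ Ω, lap u x = -2) :
    ∀ x ∈ closure Ω, 0 ≤ u x :=
  nonneg_of_superharmonic hn hbdd hopen hcont (fun x hx => (hbd x hx).ge) fun x hx =>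
    ⟨_, _, (hlap x hx).trans_le (by norm_num), fun _ => hsmooth.hasTwoJetAtZero hopen hx _⟩

theorem torsion_pos (hn : 0 < n) (hbdd : Bornology.IsBounded Ω) (hopen : IsOpen Ω)
    (hcont : ContinuousOn u (closure Ω)) (hbd : ∀ x ∈ frontier Ω, u x = 0)
    (hsmooth : ContDiffOn ℝ 2 u Ω) (hlap : ∀ x ∈ Ω, lap u x = -2) :
    ∀ x ∈ Ω, 0 < u x := by
  intro x hx
  obtain ⟨r, hr, hball⟩ := Metric.isOpen_iff.1 hopen x hx
  have hn' : (0 : ℝ) < n := by exact_mod_cast hn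
  have h := nonneg_of_superharmonic hn hbdd hopen
    (w := fun y => u y - (n : ℝ)⁻¹ * (r ^ 2 - ‖y - x‖ ^ 2)) (by fun_prop) ?_ ?_ x
    (subset_closure hx)
  · have : 0 < (n : ℝ)⁻¹ * r ^ 2 := by positivity
    simp at h
    linarith
  · intro y hy
    have hyr : r ≤ ‖y - x‖ := by
      by_contra! hlt
      rw [hopen.frontier_eq] at hy
      exact hy.2 (hball (by rwa [Metric.mem_ball, dist_eq_norm]))
    have : r ^ 2 ≤ ‖y - x‖ ^ 2 := pow_le_pow_left₀ hr.le hyr 2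
    rw [hbd y hy]
    nlinarith [inv_pos.2 hn']
  · intro y hy
    refine ⟨_, _, ?_, fun i =>
      ((hsmooth.hasTwoJetAtZero hopen hy (EuclideanSpace.single i 1)).sub
        ((HasTwoJetAtZero.quadratic (-1) (-(2 * (y - x) i)) (r ^ 2 - ‖y - x‖ ^ 2)).const_mul
          (n : ℝ)⁻¹)).congr fun s => ?_⟩
    rotate_left
    · rw [add_sub_right_comm, EuclideanSpace.norm_sq_add_smul_single]
      ring
    · have h := hlap y hy
      rw [lap] at h
      rw [Finset.sum_sub_distrib, h]
      simp
      field_simp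
      norm_num

/-- The torsion function dominates its homothetic copies centred at points of the closure. -/
theorem torsion_homothety_le (hn : 0 < n) (hbdd : Bornology.IsBounded Ω) (hopen : IsOpen Ω)
    (hconv : Convex ℝ Ω)
    (hcont : ContinuousOn u (closure Ω)) (hbd : ∀ x ∈ frontier Ω, u x = 0)
    (hsmooth : ContDiffOn ℝ 2 u Ω) (hlap : ∀ x ∈ Ω, lap u x = -2)
    {z : EuclideanSpace ℝ (Fin n)} (hz : z ∈ closure Ω) {a b : ℝ} (ha : 0 ≤ a) (hb : 0 < b)
    (hab : a + b = 1) :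
    ∀ y ∈ closure Ω, b ^ 2 * u y ≤ u (a • z + b • y) := by
  have hmaps : MapsTo (fun y => a • z + b • y) (closure Ω) (closure Ω) := fun y hy =>
    hconv.closure hz hy ha hb.le hab
  have h := nonneg_of_superharmonic hn hbdd hopen
    (w := fun y => u (a • z + b • y) - b ^ 2 * u y) ?_ ?_ ?_
  · exact fun y hy => sub_nonneg.1 (h y hy)
  · exact (hcont.comp (by fun_prop) hmaps).sub (continuousOn_const.mul hcont)
  · intro y hy
    rw [hbd y hy]
    simpa using torsion_nonneg hn hbdd hopen hcont hbd hsmooth hlap _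
      (hmaps (frontier_subset_closure hy))
  · intro y hy
    have hmem : a • z + b • y ∈ Ω := by
      have := hconv.combo_closure_interior_mem_interior hz (hopen.interior_eq.symm ▸ hy) ha hb hab
      rwa [hopen.interior_eq] at this
    refine ⟨_, _, ?_, fun i =>
      (((hsmooth.hasTwoJetAtZero hopen hmem (EuclideanSpace.single i 1)).comp_mul b).sub
        ((hsmooth.hasTwoJetAtZero hopen hy (EuclideanSpace.single i 1)).const_mul (b ^ 2))).congr
        fun s => ?_⟩
    rotate_left
    · congr 2
      module
    · have h1 := hlap y hy
      have h2 := hlap _ hmem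
      rw [lap] at h1 h2
      rw [Finset.sum_sub_distrib, ← Finset.mul_sum, ← Finset.mul_sum, h1, h2]
      simp

/-- The concavity maximum principle: an interior minimum of the concavity defect of `√u`
is nonnegative. -/
theorem torsion_sqrt_combo_le_of_isLocalMin (hopen : IsOpen Ω)
    (hpos : ∀ x ∈ Ω, 0 < u x) (hsmooth : ContDiffOn ℝ 2 u Ω) (hlap : ∀ x ∈ Ω, lap u x = -2)
    {a b : ℝ} (ha : 0 < a) (hb : 0 < b) {x y : EuclideanSpace ℝ (Fin n)}
    (hx : x ∈ Ω) (hy : y ∈ Ω) (hz : a • x + b • y ∈ Ω)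
    (hmin : IsLocalMin (fun p : EuclideanSpace ℝ (Fin n) × EuclideanSpace ℝ (Fin n) =>
      √(u (a • p.1 + b • p.2)) - a * √(u p.1) - b * √(u p.2)) (x, y)) :
    a * √(u x) + b * √(u y) ≤ √(u (a • x + b • y)) := by
  set z := a • x + b • y with hzdef
  have jet : ∀ {t}, t ∈ Ω → ∀ i, HasTwoJetAtZero
      (fun s : ℝ => √(u (t + s • EuclideanSpace.single i (1 : ℝ))))
      (fderiv ℝ u t (EuclideanSpace.single i 1) / (2 * √(u t)))
      (fderiv ℝ (fun y => fderiv ℝ u y (EuclideanSpace.single i 1)) t (EuclideanSpace.single i 1)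
        / (2 * √(u t))
        - (fderiv ℝ u t (EuclideanSpace.single i 1) / (2 * √(u t))) ^ 2 / √(u t)) := by
    intro t ht i
    simpa using (hsmooth.hasTwoJetAtZero hopen ht (EuclideanSpace.single i 1)).sqrt
      (by simpa using hpos t ht)
  have hsum : ∀ {t}, t ∈ Ω → ∑ i,
      (fderiv ℝ (fun y => fderiv ℝ u y (EuclideanSpace.single i 1)) t (EuclideanSpace.single i 1)
        / (2 * √(u t))
        - (fderiv ℝ u t (EuclideanSpace.single i 1) / (2 * √(u t))) ^ 2 / √(u t)) =
      -(1 + ∑ i, (fderiv ℝ u t (EuclideanSpace.single i 1) / (2 * √(u t))) ^ 2) / √(u t) := by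
    intro t ht
    have hs := Real.sqrt_pos.2 (hpos t ht)
    have h1 := hlap t ht
    rw [lap] at h1
    rw [Finset.sum_sub_distrib, ← Finset.sum_div, ← Finset.sum_div, h1]
    field_simp
    ring
  generalize hD : (fun t i => fderiv ℝ u t (EuclideanSpace.single i 1) / (2 * √(u t))) = D
  generalize hH : (fun t i =>
    fderiv ℝ (fun y => fderiv ℝ u y (EuclideanSpace.single i 1)) t (EuclideanSpace.single i 1)
        / (2 * √(u t))
        - (fderiv ℝ u t (EuclideanSpace.single i 1) / (2 * √(u t))) ^ 2 / √(u t)) = H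
  replace jet : ∀ {t}, t ∈ Ω → ∀ i, HasTwoJetAtZero
      (fun s : ℝ => √(u (t + s • EuclideanSpace.single i (1 : ℝ)))) (D t i) (H t i) := by
    subst hD hH; exact jet
  replace hsum : ∀ {t}, t ∈ Ω → ∑ i, H t i = -(1 + ∑ i, D t i ^ 2) / √(u t) := by
    subst hD hH; exact hsum
  have defect : ∀ (k l : ℝ) (i : Fin n),
      (a * k + b * l) * D z i - a * (k * D x i) - b * (l * D y i) = 0 ∧
      0 ≤ (a * k + b * l) ^ 2 * H z i - a * (k ^ 2 * H x i) - b * (l ^ 2 * H y i) := by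
    intro k l i
    have hj := ((((jet hz i).comp_mul (a * k + b * l)).sub
      (((jet hx i).comp_mul k).const_mul a)).sub (((jet hy i).comp_mul l).const_mul b))
    have hm : IsLocalMin (fun s : ℝ =>
        √(u (z + ((a * k + b * l) * s) • EuclideanSpace.single i (1 : ℝ)))
        - a * √(u (x + (k * s) • EuclideanSpace.single i (1 : ℝ)))
        - b * √(u (y + (l * s) • EuclideanSpace.single i (1 : ℝ)))) 0 := by
      have hc : Continuous fun s : ℝ => (x + (k * s) • EuclideanSpace.single i (1 : ℝ),
          y + (l * s) • EuclideanSpace.single i (1 : ℝ)) := by fun_prop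
      have ht := hc.tendsto 0
      simp only [mul_zero, zero_smul, add_zero] at ht
      filter_upwards [ht.eventually hmin] with s hs
      have hcombo : z + ((a * k + b * l) * s) • EuclideanSpace.single i (1 : ℝ) =
          a • (x + (k * s) • EuclideanSpace.single i (1 : ℝ)) +
          b • (y + (l * s) • EuclideanSpace.single i (1 : ℝ)) := by
        rw [hzdef]; module
      simpa [hcombo] using hs
    exact ⟨hj.eq_zero_of_isLocalMin hm, hj.nonneg_of_isLocalMin hm⟩
  have hDx : ∀ i, D x i = D z i := fun i => by
    have h := (defect 1 0 i).1
    exact mul_left_cancel₀ ha.ne' (by linarith)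
  have hDy : ∀ i, D y i = D z i := fun i => by
    have h := (defect 0 1 i).1
    exact mul_left_cancel₀ hb.ne' (by linarith)
  have hX := Real.sqrt_pos.2 (hpos x hx)
  have hY := Real.sqrt_pos.2 (hpos y hy)
  have hZ := Real.sqrt_pos.2 (hpos z hz)
  have hfin := Finset.sum_nonneg fun i (_ : i ∈ Finset.univ) => (defect √(u x) √(u y) i).2
  simp only [Finset.sum_sub_distrib, ← Finset.mul_sum] at hfin
  rw [hsum hx, hsum hy, hsum hz] at hfin
  simp only [hDx, hDy] at hfin
  have hK : 0 < 1 + ∑ i, D z i ^ 2 := by positivity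
  generalize 1 + ∑ i, D z i ^ 2 = K at hfin hK
  generalize √(u x) = X at *
  generalize √(u y) = Y at *
  generalize √(u z) = Z at *
  have hM : 0 < a * X + b * Y := by positivity
  have hfin' : 0 ≤ (K * (a * X + b * Y) / Z) * (Z - (a * X + b * Y)) := by
    refine hfin.trans_eq ?_
    field_simp
    ring
  exact sub_nonneg.1 (nonneg_of_mul_nonneg_right hfin' (by positivity))

end Torsion

theorem sqrt_of_torsion_function_concave
    {n : ℕ} (hn : 2 ≤ n)
    (Ω : Set (EuclideanSpace ℝ (Fin n)))
    (hne : Ω.Nonempty) (hbdd : Bornology.IsBounded Ω) (hopen : IsOpen Ω)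
    (hconv : Convex ℝ Ω)
    (u : EuclideanSpace ℝ (Fin n) → ℝ)
    (hcont : ContinuousOn u (closure Ω))
    (hbd : ∀ x ∈ frontier Ω, u x = 0)
    (hsmooth : ContDiffOn ℝ 2 u Ω)
    (hlap : ∀ x ∈ Ω, lap u x = -2) :
    (∀ x ∈ Ω, 0 ≤ u x) ∧ ConcaveOn ℝ Ω (fun x => Real.sqrt (u x)) := by
  have hn0 : 0 < n := by omega
  have hnonneg := torsion_nonneg hn0 hbdd hopen hcont hbd hsmooth hlap
  have hpos := torsion_pos hn0 hbdd hopen hcont hbd hsmooth hlap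
  refine ⟨fun x hx => hnonneg x (subset_closure hx),
    concaveOn_iff_forall_pos.2 ⟨hconv, fun x hx y hy a b ha hb hab => ?_⟩⟩
  have hmaps : MapsTo (fun p : EuclideanSpace ℝ (Fin n) × EuclideanSpace ℝ (Fin n) =>
      a • p.1 + b • p.2) (closure Ω ×ˢ closure Ω) (closure Ω) := fun p hp =>
    hconv.closure hp.1 hp.2 ha.le hb.le hab
  obtain ⟨⟨x₀, y₀⟩, ⟨hx₀, hy₀⟩, hmin⟩ :=
    (hbdd.isCompact_closure.prod hbdd.isCompact_closure).exists_isMinOn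
      ⟨(x, y), subset_closure hx, subset_closure hy⟩
      (f := fun p : EuclideanSpace ℝ (Fin n) × EuclideanSpace ℝ (Fin n) =>
        √(u (a • p.1 + b • p.2)) - a * √(u p.1) - b * √(u p.2))
      (((hcont.comp (by fun_prop) hmaps).sqrt.sub
        (continuousOn_const.mul (hcont.comp continuousOn_fst fun p hp => hp.1).sqrt)).sub
        (continuousOn_const.mul (hcont.comp continuousOn_snd fun p hp => hp.2).sqrt))
  have hdefect : a * √(u x₀) + b * √(u y₀) ≤ √(u (a • x₀ + b • y₀)) := by
    by_cases hxΩ : x₀ ∈ Ω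
    · by_cases hyΩ : y₀ ∈ Ω
      · refine torsion_sqrt_combo_le_of_isLocalMin hopen hpos hsmooth hlap ha hb hxΩ hyΩ
          (hconv hxΩ hyΩ ha.le hb.le hab) (hmin.isLocalMin ?_)
        exact mem_of_superset ((hopen.prod hopen).mem_nhds ⟨hxΩ, hyΩ⟩)
          (prod_mono subset_closure subset_closure)
      · have hy0 : u y₀ = 0 := hbd y₀ (hopen.frontier_eq ▸ ⟨hy₀, hyΩ⟩)
        have h := torsion_homothety_le hn0 hbdd hopen hconv hcont hbd hsmooth hlap hy₀ hb.le ha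
          (by linarith) x₀ hx₀
        rw [hy0, add_comm (a • x₀)]
        simpa [Real.sqrt_mul (sq_nonneg a), Real.sqrt_sq ha.le] using Real.sqrt_le_sqrt h
    · have hx0 : u x₀ = 0 := hbd x₀ (hopen.frontier_eq ▸ ⟨hx₀, hxΩ⟩)
      have h := torsion_homothety_le hn0 hbdd hopen hconv hcont hbd hsmooth hlap hx₀ ha.le hb
        hab y₀ hy₀
      rw [hx0]
      simpa [Real.sqrt_mul (sq_nonneg b), Real.sqrt_sq hb.le] using Real.sqrt_le_sqrt h
  have h := hmin (show (x, y) ∈ closure Ω ×ˢ closure Ω from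
    ⟨subset_closure hx, subset_closure hy⟩)
  simp only [mem_ofPred_eq] at h
  simp only [smul_eq_mul]
  linarith
end
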